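/- There exist a constant C > 0 and an integer M ≥ 0 such that ‖Op(a)u‖_{L²(dq)} ≤ C |a|_{M,0,0} ‖u‖_{L²(dq)} for all bisymbols a ∈ BS^0_0(1) and all u ∈ C_c^∞(ℝ^n) (Calderón–Vaillancourt theorem for bounded bisymbols on ℝ^n). -/

import Mathlib

open MeasureTheory Real
open scoped BigOperators Classical

noncomputable section

/-- Points of `ℝⁿ`. The coordinate `q 0` plays the role of the radial variable `r`,
the remaining coordinates are the angular variables `θ`. -/
abbrev Vec (n : ℕ) := Fin n → ℝ

/-- Complex-valued partial derivative in the coordinate direction `i`. -/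
def pdC {n : ℕ} (i : Fin n) (f : Vec n → ℂ) : Vec n → ℂ :=
  fun x => fderiv ℝ f x (Pi.single i 1)

/-- Iterated (multiindex) partial derivative `∂^A f`. -/
def mpd {n : ℕ} (A : Fin n → ℕ) (f : Vec n → ℂ) : Vec n → ℂ :=
  (List.finRange n).foldr (fun i g => (pdC i)^[A i] g) f

/-- Real-valued partial derivative in the coordinate direction `i`. -/
def pdR {n : ℕ} (i : Fin n) (f : Vec n → ℝ) : Vec n → ℝ :=
  fun x => fderiv ℝ f x (Pi.single i 1)

/-- Iterated (multiindex) partial derivative, real valued. -/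
def mpdR {n : ℕ} (A : Fin n → ℕ) (f : Vec n → ℝ) : Vec n → ℝ :=
  (List.finRange n).foldr (fun i g => (pdR i)^[A i] g) f

/-- Total length `|A| = α₀ + |α|` of a multiindex. -/
def fullLen {n : ℕ} (A : Fin n → ℕ) : ℕ := ∑ i, A i

/-- Angular length `|α|` of a multiindex `A = (α₀, α)`. -/
def angLen {n : ℕ} [NeZero n] (A : Fin n → ℕ) : ℕ := ∑ i, if i = 0 then 0 else A i

/-- The weighted Japanese bracket `⟨ρ ⊕ μ⁻¹ η⟩ = (1 + ρ² + μ⁻²|η|²)^(1/2)`,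
where `ρ = p 0` and `η` are the remaining coordinates of `p`. -/
def jbr {n : ℕ} [NeZero n] (μ : ℝ) (p : Vec n) : ℝ :=
  Real.sqrt (1 + ∑ i, (if i = 0 then p i else μ⁻¹ * p i) ^ 2)

/-- Derivative `∂_q^A` of a function `a(q, p)` in the first slot. -/
def dqS {n : ℕ} (A : Fin n → ℕ) (a : Vec n → Vec n → ℂ) : Vec n → Vec n → ℂ :=
  fun q p => mpd A (fun x => a x p) q

/-- Derivative `∂_p^B` of a function `a(q, p)` in the second slot. -/
def dpS {n : ℕ} (B : Fin n → ℕ) (a : Vec n → Vec n → ℂ) : Vec n → Vec n → ℂ :=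
  fun q p => mpd B (fun x => a q x) p

/-- Derivative `∂_q^A` of a function `a(q, p, q')` in the first slot. -/
def d1B {n : ℕ} (A : Fin n → ℕ) (a : Vec n → Vec n → Vec n → ℂ) :
    Vec n → Vec n → Vec n → ℂ :=
  fun q p q' => mpd A (fun x => a x p q') q

/-- Derivative `∂_p^B` of a function `a(q, p, q')` in the second slot. -/
def d2B {n : ℕ} (B : Fin n → ℕ) (a : Vec n → Vec n → Vec n → ℂ) :
    Vec n → Vec n → Vec n → ℂ :=
  fun q p q' => mpd B (fun x => a q x q') p

/-- Derivative `∂_{q'}^{A'}` of a function `a(q, p, q')` in the third slot. -/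
def d3B {n : ℕ} (A' : Fin n → ℕ) (a : Vec n → Vec n → Vec n → ℂ) :
    Vec n → Vec n → Vec n → ℂ :=
  fun q p q' => mpd A' (fun x => a q p x) q'

/-- The admissibility condition for the weight `λ : ℝ → (0,∞)`:
`λ` is positive and `C₀⁻¹ ≤ λ(r)/λ(r') ≤ C₀` whenever `|r - r'| ≤ 1`. -/
def Admissible (lam : ℝ → ℝ) : Prop :=
  (∀ r, 0 < lam r) ∧
  ∃ C > 0, ∀ r r' : ℝ, |r - r'| ≤ 1 → C⁻¹ ≤ lam r / lam r' ∧ lam r / lam r' ≤ C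

/-- The symbol class `S^m_σ(λ)`:  `a` is smooth on `ℝ^{2n}` and for all multiindices
`A = (α₀, α)`, `B = (β₀, β)`,
`|(λ(r)⁻¹∂_θ)^α (λ(r)∂_η)^β ∂_r^{α₀} ∂_ρ^{β₀} a(q,p)| ≤ C ⟨ρ ⊕ λ(r)⁻¹η⟩^{m - σ|B|}`.
(The weights `λ(r)^{±1}` commute with the `θ`- and `η`-derivatives, so the weighted
derivative equals `λ(r)^{|β| - |α|}` times the plain mixed partial derivative.) -/
def IsSymbol {n : ℕ} [NeZero n] (lam : ℝ → ℝ) (m σ : ℝ) (a : Vec n → Vec n → ℂ) : Prop :=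
  ContDiff ℝ (⊤ : ℕ∞) (fun x : Vec n × Vec n => a x.1 x.2) ∧
  ∀ A B : Fin n → ℕ, ∃ C > 0, ∀ q p : Vec n,
    lam (q 0) ^ ((angLen B : ℤ) - (angLen A : ℤ)) * ‖dqS A (dpS B a) q p‖
      ≤ C * jbr (lam (q 0)) p ^ (m - σ * (fullLen B : ℝ))

/-- The seminorm `|a|_{λ : M, m, σ}` on the symbol class `S^m_σ(λ)`. -/
def symSeminorm {n : ℕ} [NeZero n] (lam : ℝ → ℝ) (M : ℕ) (m σ : ℝ)
    (a : Vec n → Vec n → ℂ) : ℝ :=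
  ∑ A : Fin n → Fin (M + 1), ∑ B : Fin n → Fin (M + 1),
    if fullLen (fun i => (A i : ℕ)) + fullLen (fun i => (B i : ℕ)) ≤ M then
      ⨆ q : Vec n, ⨆ p : Vec n,
        jbr (lam (q 0)) p ^ (-m + σ * (fullLen (fun i => (B i : ℕ)) : ℝ)) *
          (lam (q 0) ^ ((angLen (fun i => (B i : ℕ)) : ℤ) - (angLen (fun i => (A i : ℕ)) : ℤ)) *
            ‖dqS (fun i => (A i : ℕ)) (dpS (fun i => (B i : ℕ)) a) q p‖)
    else 0

/-- `λ^t_{jk} := λ(tj + (1-t)k)`. -/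
def lamT (lam : ℝ → ℝ) (t : ℝ) (j k : ℤ) : ℝ := lam (t * j + (1 - t) * k)

/-- The bisymbol class `BS^m_σ(λ; t)`. -/
def IsBisymbol {n : ℕ} [NeZero n] (lam : ℝ → ℝ) (m σ t : ℝ)
    (a : Vec n → Vec n → Vec n → ℂ) : Prop :=
  ContDiff ℝ (⊤ : ℕ∞) (fun x : Vec n × Vec n × Vec n => a x.1 x.2.1 x.2.2) ∧
  ∀ A B A' : Fin n → ℕ, ∃ C > 0, ∀ (j k : ℤ) (q p q' : Vec n),
    |q 0 - (j : ℝ)| ≤ 1 → |q' 0 - (k : ℝ)| ≤ 1 →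
    lamT lam t j k ^ ((angLen B : ℤ) - (angLen A : ℤ) - (angLen A' : ℤ)) *
        ‖d1B A (d2B B (d3B A' a)) q p q'‖
      ≤ C * jbr (lamT lam t j k) p ^ (m - σ * (fullLen B : ℝ))

/-- The seminorm `|a|_{λ : M, m, σ, t}` on `BS^m_σ(λ; t)`. -/
def bisymSeminorm {n : ℕ} [NeZero n] (lam : ℝ → ℝ) (M : ℕ) (m σ t : ℝ)
    (a : Vec n → Vec n → Vec n → ℂ) : ℝ :=
  ∑ A : Fin n → Fin (M + 1), ∑ B : Fin n → Fin (M + 1), ∑ A' : Fin n → Fin (M + 1),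
    if fullLen (fun i => (A i : ℕ)) + fullLen (fun i => (B i : ℕ))
        + fullLen (fun i => (A' i : ℕ)) ≤ M then
      ⨆ j : ℤ, ⨆ k : ℤ, ⨆ q : Vec n, ⨆ p : Vec n, ⨆ q' : Vec n,
        if |q 0 - (j : ℝ)| ≤ 1 ∧ |q' 0 - (k : ℝ)| ≤ 1 then
          jbr (lamT lam t j k) p ^ (-m + σ * (fullLen (fun i => (B i : ℕ)) : ℝ)) *
            (lamT lam t j k ^ ((angLen (fun i => (B i : ℕ)) : ℤ)
                - (angLen (fun i => (A i : ℕ)) : ℤ) - (angLen (fun i => (A' i : ℕ)) : ℤ)) *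
              ‖d1B (fun i => (A i : ℕ)) (d2B (fun i => (B i : ℕ))
                  (d3B (fun i => (A' i : ℕ)) a)) q p q'‖)
        else 0
    else 0

/-- The plain bisymbol class `BS^m_σ(1)` (the case `λ ≡ 1`). -/
def IsBisymbolOne {n : ℕ} [NeZero n] (m σ : ℝ) (a : Vec n → Vec n → Vec n → ℂ) : Prop :=
  ContDiff ℝ (⊤ : ℕ∞) (fun x : Vec n × Vec n × Vec n => a x.1 x.2.1 x.2.2) ∧
  ∀ A B A' : Fin n → ℕ, ∃ C > 0, ∀ q p q' : Vec n,
    ‖d1B A (d2B B (d3B A' a)) q p q'‖ ≤ C * jbr 1 p ^ (m - σ * (fullLen B : ℝ))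

/-- The seminorm `|a|_{M, m, σ}` on `BS^m_σ(1)`. -/
def bisymSeminormOne {n : ℕ} [NeZero n] (M : ℕ) (m σ : ℝ)
    (a : Vec n → Vec n → Vec n → ℂ) : ℝ :=
  ∑ A : Fin n → Fin (M + 1), ∑ B : Fin n → Fin (M + 1), ∑ A' : Fin n → Fin (M + 1),
    if fullLen (fun i => (A i : ℕ)) + fullLen (fun i => (B i : ℕ))
        + fullLen (fun i => (A' i : ℕ)) ≤ M then
      ⨆ q : Vec n, ⨆ p : Vec n, ⨆ q' : Vec n,
        jbr 1 p ^ (-m + σ * (fullLen (fun i => (B i : ℕ)) : ℝ)) *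
          ‖d1B (fun i => (A i : ℕ)) (d2B (fun i => (B i : ℕ))
              (d3B (fun i => (A' i : ℕ)) a)) q p q'‖
    else 0

/-- The oscillatory phase `e^{i p · (q - q')}`. -/
def phase {n : ℕ} (p q q' : Vec n) : ℂ :=
  Complex.exp (Complex.I * ((∑ i, p i * (q i - q' i) : ℝ) : ℂ))

/-- The pseudodifferential operator `Op^g(a)` with bisymbol `a`, as an iterated integral:
`Op^g(a)u(q) = (2π)^{-n} g(q)^{-1/4} ∫ dp ∫ dq' a(q,p,q') e^{ip⋅(q-q')} u(q') g(q')^{1/4}`. -/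
def OpG {n : ℕ} (g : Vec n → ℝ) (a : Vec n → Vec n → Vec n → ℂ) (u : Vec n → ℂ) :
    Vec n → ℂ :=
  fun q => (((2 * Real.pi) ^ (-(n : ℤ)) : ℝ) : ℂ) * ((g q ^ (-(1 : ℝ) / 4) : ℝ) : ℂ) *
    ∫ p : Vec n, ∫ q' : Vec n,
      a q p q' * phase p q q' * u q' * ((g q' ^ ((1 : ℝ) / 4) : ℝ) : ℂ)

/-- The pseudodifferential operator `Op(a) = Op^1(a)` with bisymbol `a`. -/
def Op {n : ℕ} (a : Vec n → Vec n → Vec n → ℂ) (u : Vec n → ℂ) : Vec n → ℂ :=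
  fun q => (((2 * Real.pi) ^ (-(n : ℤ)) : ℝ) : ℂ) *
    ∫ p : Vec n, ∫ q' : Vec n, a q p q' * phase p q q' * u q'

/-- The `t`-quantization `Op^{g,t}(a)` of a symbol `a`. -/
def OpSt {n : ℕ} (g : Vec n → ℝ) (t : ℝ) (a : Vec n → Vec n → ℂ) (u : Vec n → ℂ) :
    Vec n → ℂ :=
  OpG g (fun q p q' => a (t • q + (1 - t) • q') p) u

/-- The quantization `Op(b)` of a symbol `b` (the case `t = 1`, `g ≡ 1`). -/
def OpSym {n : ℕ} (b : Vec n → Vec n → ℂ) (u : Vec n → ℂ) : Vec n → ℂ :=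
  Op (fun q p _ => b q p) u

/-- The `L²(g^{1/2}dq)` norm. -/
def L2g {n : ℕ} (g : Vec n → ℝ) (f : Vec n → ℂ) : ℝ :=
  Real.sqrt (∫ q : Vec n, ‖f q‖ ^ 2 * Real.sqrt (g q))

/-- The `L²(dq)` norm. -/
def L2 {n : ℕ} (f : Vec n → ℂ) : ℝ :=
  Real.sqrt (∫ q : Vec n, ‖f q‖ ^ 2)

end

/-- The derivative of `f` in the direction `d`. -/
noncomputable def dirDeriv {X : Type*} [NormedAddCommGroup X] [NormedSpace ℝ X]
    (d : X) (f : X → ℂ) : X → ℂ := fun x => fderiv ℝ f x d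

/-- The operator `1 + ∂_d`. -/
noncomputable def dirOp {X : Type*} [NormedAddCommGroup X] [NormedSpace ℝ X]
    (d : X) (f : X → ℂ) : X → ℂ := fun x => f x + fderiv ℝ f x d

/-- The composition of the operators `1 + ∂_d`, where `d` runs through a list; the head of the
list acts first. -/
noncomputable def dirOpList {X : Type*} [NormedAddCommGroup X] [NormedSpace ℝ X]
    (L : List X) (f : X → ℂ) : X → ℂ := L.foldl (fun g d => dirOp d g) f

/-- All iterated derivatives of `f` of order at most `M` in directions from `D` are bounded by
`S * W`. -/
def DerivBound {X : Type*} [NormedAddCommGroup X] [NormedSpace ℝ X]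
    (D : Set X) (W : X → ℝ) (S : ℝ) : ℕ → (X → ℂ) → Prop
  | 0, f => ∀ x, ‖f x‖ ≤ S * W x
  | M + 1, f => (∀ x, ‖f x‖ ≤ S * W x) ∧ ∀ d ∈ D, DerivBound D W S M (dirDeriv d f)

section DirectionalDerivatives

variable {X : Type*} [NormedAddCommGroup X] [NormedSpace ℝ X]

lemma contDiff_dirDeriv {f : X → ℂ} (hf : ContDiff ℝ (⊤ : ℕ∞) f) (d : X) :
    ContDiff ℝ (⊤ : ℕ∞) (dirDeriv d f) :=
  (hf.fderiv_right (m := (⊤ : ℕ∞)) (by simp)).clm_apply contDiff_const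

lemma contDiff_dirOp {f : X → ℂ} (hf : ContDiff ℝ (⊤ : ℕ∞) f) (d : X) :
    ContDiff ℝ (⊤ : ℕ∞) (dirOp d f) := hf.add (contDiff_dirDeriv hf d)

lemma contDiff_dirOpList {f : X → ℂ} (hf : ContDiff ℝ (⊤ : ℕ∞) f) (L : List X) :
    ContDiff ℝ (⊤ : ℕ∞) (dirOpList L f) := by
  induction L generalizing f with
  | nil => exact hf
  | cons d L ih => exact ih (contDiff_dirOp hf d)

namespace DerivBound

variable {D : Set X} {W W' : X → ℝ} {S T : ℝ} {M : ℕ} {f g : X → ℂ}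

lemma norm_le (h : DerivBound D W S M f) (x : X) : ‖f x‖ ≤ S * W x := by
  cases M with
  | zero => exact h x
  | succ M => exact h.1 x

lemma of_succ (h : DerivBound D W S (M + 1) f) : DerivBound D W S M f := by
  induction M generalizing f with
  | zero => exact h.1
  | succ M ih => exact ⟨h.1, fun d hd => ih (h.2 d hd)⟩

lemma of_le {M' : ℕ} (hM : M' ≤ M) (h : DerivBound D W S M f) : DerivBound D W S M' f := by
  induction hM with
  | refl => exact h
  | step _ ih => exact ih h.of_succ

lemma mono (h : DerivBound D W S M f) (hST : ∀ x, S * W x ≤ T * W' x) :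
    DerivBound D W' T M f := by
  induction M generalizing f with
  | zero => exact fun x => (h x).trans (hST x)
  | succ M ih => exact ⟨fun x => (h.1 x).trans (hST x), fun d hd => ih (h.2 d hd)⟩

lemma add (hf : ContDiff ℝ (⊤ : ℕ∞) f) (hg : ContDiff ℝ (⊤ : ℕ∞) g)
    (bf : DerivBound D W S M f) (bg : DerivBound D W T M g) :
    DerivBound D W (S + T) M (fun x => f x + g x) := by
  have key : ∀ x, ‖f x + g x‖ ≤ (S + T) * W x := fun x => by
    rw [add_mul]
    exact norm_add_le_of_le (bf.norm_le x) (bg.norm_le x)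
  induction M generalizing f g with
  | zero => exact key
  | succ M ih =>
    refine ⟨key, fun d hd => ?_⟩
    have e : dirDeriv d (fun x => f x + g x) = fun x => dirDeriv d f x + dirDeriv d g x := by
      funext x
      simp only [dirDeriv]
      rw [fderiv_fun_add (hf.differentiable (by simp) x) (hg.differentiable (by simp) x)]
      rfl
    rw [e]
    exact ih (contDiff_dirDeriv hf d) (contDiff_dirDeriv hg d) (bf.2 d hd) (bg.2 d hd)
      (fun x => by
        rw [add_mul]
        exact norm_add_le_of_le ((bf.2 d hd).norm_le x) ((bg.2 d hd).norm_le x))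

lemma const_mul (hf : ContDiff ℝ (⊤ : ℕ∞) f) (bf : DerivBound D W S M f) (c : ℂ) :
    DerivBound D W (‖c‖ * S) M (fun x => c * f x) := by
  induction M generalizing f with
  | zero =>
    intro x
    rw [norm_mul, mul_assoc]
    exact mul_le_mul_of_nonneg_left (bf x) (norm_nonneg c)
  | succ M ih =>
    refine ⟨fun x => ?_, fun d hd => ?_⟩
    · rw [norm_mul, mul_assoc]
      exact mul_le_mul_of_nonneg_left (bf.1 x) (norm_nonneg c)
    · have e : dirDeriv d (fun x => c * f x) = fun x => c * dirDeriv d f x := by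
        funext x
        simp only [dirDeriv]
        rw [fderiv_const_mul (hf.differentiable (by simp) x)]
        rfl
      rw [e]
      exact ih (contDiff_dirDeriv hf d) (bf.2 d hd)

lemma mul (hS : 0 ≤ S) (hT : 0 ≤ T) (hW : ∀ x, 0 ≤ W x) (hW' : ∀ x, 0 ≤ W' x)
    (hf : ContDiff ℝ (⊤ : ℕ∞) f) (hg : ContDiff ℝ (⊤ : ℕ∞) g)
    (bf : DerivBound D W S M f) (bg : DerivBound D W' T M g) :
    DerivBound D (fun x => W x * W' x) (2 ^ M * (S * T)) M (fun x => f x * g x) := by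
  have key : ∀ x, ‖f x * g x‖ ≤ (S * T) * (W x * W' x) := fun x => by
    rw [norm_mul, show (S * T) * (W x * W' x) = (S * W x) * (T * W' x) by ring]
    exact mul_le_mul (bf.norm_le x) (bg.norm_le x) (norm_nonneg _) (mul_nonneg hS (hW x))
  induction M generalizing f g with
  | zero => exact fun x => by simpa only [pow_zero, one_mul] using key x
  | succ M ih =>
    refine ⟨fun x => (key x).trans ?_, fun d hd => ?_⟩
    · refine mul_le_mul_of_nonneg_right ?_ (mul_nonneg (hW x) (hW' x))
      exact le_mul_of_one_le_left (mul_nonneg hS hT) (one_le_pow₀ (by norm_num))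
    · have e : dirDeriv d (fun x => f x * g x)
          = fun x => dirDeriv d f x * g x + f x * dirDeriv d g x := by
        funext x
        simp only [dirDeriv]
        rw [fderiv_fun_mul (hf.differentiable (by simp) x) (hg.differentiable (by simp) x)]
        simp only [add_apply, smul_apply, smul_eq_mul]
        ring
      have key' : ∀ {f' g' : X → ℂ}, DerivBound D W S M f' → DerivBound D W' T M g' →
          ∀ x, ‖f' x * g' x‖ ≤ (S * T) * (W x * W' x) := fun bf' bg' x => by
        rw [norm_mul, show (S * T) * (W x * W' x) = (S * W x) * (T * W' x) by ring]
        exact mul_le_mul (bf'.norm_le x) (bg'.norm_le x) (norm_nonneg _) (mul_nonneg hS (hW x))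
      rw [e, show (2 : ℝ) ^ (M + 1) * (S * T) = 2 ^ M * (S * T) + 2 ^ M * (S * T) by ring]
      exact add ((contDiff_dirDeriv hf d).mul hg) (hf.mul (contDiff_dirDeriv hg d))
        (ih (contDiff_dirDeriv hf d) hg (bf.2 d hd) bg.of_succ (key' (bf.2 d hd) bg.of_succ))
        (ih hf (contDiff_dirDeriv hg d) bf.of_succ (bg.2 d hd) (key' bf.of_succ (bg.2 d hd)))

lemma dirOp (hf : ContDiff ℝ (⊤ : ℕ∞) f) (bf : DerivBound D W S (M + 1) f) {d : X}
    (hd : d ∈ D ∨ -d ∈ D) : DerivBound D W (2 * S) M (_root_.dirOp d f) := by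
  rw [two_mul]
  refine add hf (contDiff_dirDeriv hf d) bf.of_succ ?_
  rcases hd with hd | hd
  · exact bf.2 d hd
  · have e : dirDeriv d f = fun x => (-1 : ℂ) * dirDeriv (-d) f x := by
      funext x
      simp [dirDeriv]
    have h := const_mul (contDiff_dirDeriv hf (-d)) (bf.2 (-d) hd) (-1 : ℂ)
    change DerivBound D W S M (dirDeriv d f)
    rw [e]
    simpa using h

lemma dirOpList (hf : ContDiff ℝ (⊤ : ℕ∞) f) {L : List X}
    (hL : ∀ d ∈ L, d ∈ D ∨ -d ∈ D) (bf : DerivBound D W S (M + L.length) f) :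
    DerivBound D W (2 ^ L.length * S) M (_root_.dirOpList L f) := by
  induction L generalizing f S with
  | nil => simpa using! bf
  | cons d L ih =>
    have h := ih (contDiff_dirOp hf d) (fun e he => hL e (List.mem_cons_of_mem _ he))
      (dirOp hf bf (hL d List.mem_cons_self))
    rw [List.length_cons, pow_succ, mul_assoc]
    exact h

end DerivBound

/-- The function `(1 + i ℓ)⁻¹`. -/
noncomputable def invFactor (l : X →L[ℝ] ℝ) (x : X) : ℂ := (1 + Complex.I * (l x : ℂ))⁻¹

/-- The product of the functions `(1 + i ℓ)⁻¹`, where `ℓ` runs through a list. -/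
noncomputable def invFactorProd (L : List (X →L[ℝ] ℝ)) (x : X) : ℂ :=
  (L.map fun l => invFactor l x).prod

lemma one_add_I_mul_ne_zero (t : ℝ) : (1 + Complex.I * (t : ℂ)) ≠ 0 := by
  intro h
  simpa using congrArg Complex.re h

lemma normSq_one_add_I_mul (t : ℝ) : ‖1 + Complex.I * (t : ℂ)‖ ^ 2 = 1 + t ^ 2 := by
  rw [← Complex.normSq_eq_norm_sq, Complex.normSq_apply]
  simp
  ring

lemma norm_inv_one_add_I_mul_le_one (t : ℝ) : ‖(1 + Complex.I * (t : ℂ))⁻¹‖ ≤ 1 := by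
  rw [norm_inv]
  refine inv_le_one_of_one_le₀ ?_
  have h := normSq_one_add_I_mul t
  nlinarith [sq_nonneg t, norm_nonneg (1 + Complex.I * (t : ℂ))]

lemma contDiff_one_add_I_mul (l : X →L[ℝ] ℝ) :
    ContDiff ℝ (⊤ : ℕ∞) (fun x : X => 1 + Complex.I * (l x : ℂ)) :=
  contDiff_const.add (contDiff_const.mul (Complex.ofRealCLM.contDiff.comp l.contDiff))

lemma contDiff_invFactor (l : X →L[ℝ] ℝ) : ContDiff ℝ (⊤ : ℕ∞) (invFactor l) :=
  (contDiff_one_add_I_mul l).inv fun x => one_add_I_mul_ne_zero (l x)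

lemma contDiff_invFactorProd (L : List (X →L[ℝ] ℝ)) :
    ContDiff ℝ (⊤ : ℕ∞) (invFactorProd L) := by
  induction L with
  | nil => simpa [invFactorProd] using! contDiff_const
  | cons l L ih => simpa [invFactorProd] using! (contDiff_invFactor l).mul ih

lemma dirDeriv_invFactor (l : X →L[ℝ] ℝ) (d : X) :
    dirDeriv d (invFactor l)
      = fun x => (-(Complex.I * (l d : ℂ))) * (invFactor l x * invFactor l x) := by
  funext x
  have h1 : HasFDerivAt (fun x : X => 1 + Complex.I * (l x : ℂ))
      (Complex.I • (Complex.ofRealCLM.comp l)) x :=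
    ((Complex.ofRealCLM.comp l).hasFDerivAt.const_mul Complex.I).const_add 1
  have h2 := (hasDerivAt_inv (one_add_I_mul_ne_zero (l x))).comp_hasFDerivAt x h1
  have h3 : fderiv ℝ (invFactor l) x = _ := h2.fderiv
  simp only [dirDeriv]
  rw [h3]
  simp [invFactor]
  field_simp

lemma DerivBound.invFactor {D : Set X} (M : ℕ) :
    ∃ C : ℝ, 1 ≤ C ∧ ∀ l : X →L[ℝ] ℝ, (∀ d ∈ D, |l d| ≤ 1) →
      DerivBound D (fun x => ‖invFactor l x‖) C M (_root_.invFactor l) := by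
  induction M with
  | zero => exact ⟨1, le_rfl, fun l _ x => by simp⟩
  | succ M ih =>
    obtain ⟨C, hC, h⟩ := ih
    have hp : 0 ≤ 2 ^ M * (C * C) := by positivity
    refine ⟨1 + 2 ^ M * (C * C), by linarith, fun l hl => ⟨fun x => ?_, fun d hd => ?_⟩⟩
    · nlinarith [norm_nonneg (_root_.invFactor l x)]
    · rw [dirDeriv_invFactor]
      have hb := DerivBound.const_mul ((contDiff_invFactor l).mul (contDiff_invFactor l))
        (DerivBound.mul (by linarith) (by linarith) (fun x => norm_nonneg _)
          (fun x => norm_nonneg _) (contDiff_invFactor l) (contDiff_invFactor l)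
          (h l hl) (h l hl)) (-(Complex.I * (l d : ℂ)))
      refine hb.mono fun x => ?_
      have h1 : ‖-(Complex.I * (l d : ℂ))‖ ≤ 1 := by simpa using hl d hd
      have h2 : ‖_root_.invFactor l x‖ ≤ 1 := norm_inv_one_add_I_mul_le_one _
      have h3 := norm_nonneg (_root_.invFactor l x)
      have h4 : ‖_root_.invFactor l x‖ * ‖_root_.invFactor l x‖ ≤ ‖_root_.invFactor l x‖ := by
        nlinarith
      refine mul_le_mul ?_ h4 (by positivity) (by positivity)
      nlinarith [norm_nonneg (-(Complex.I * (l d : ℂ)))]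

lemma DerivBound.invFactorProd {D : Set X} (M N : ℕ) :
    ∃ C : ℝ, 1 ≤ C ∧ ∀ L : List (X →L[ℝ] ℝ), L.length = N → (∀ l ∈ L, ∀ d ∈ D, |l d| ≤ 1) →
      DerivBound D (fun x => ‖invFactorProd L x‖) C M (_root_.invFactorProd L) := by
  induction N with
  | zero =>
    refine ⟨1, le_rfl, fun L hL _ => ?_⟩
    obtain rfl := List.length_eq_zero_iff.1 hL
    have e : _root_.invFactorProd ([] : List (X →L[ℝ] ℝ)) = fun _ => (1 : ℂ) := by
      funext x
      simp [_root_.invFactorProd]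
    have hz : ∀ M, DerivBound D (fun _ => (1 : ℝ)) 1 M (fun _ : X => (0 : ℂ)) := by
      intro M
      induction M with
      | zero => exact fun x => by simp
      | succ M ih =>
        refine ⟨fun x => by simp, fun d _ => ?_⟩
        have : dirDeriv d (fun _ : X => (0 : ℂ)) = fun _ => 0 := by
          funext x
          simp [dirDeriv]
        rwa [this]
    rw [e]
    simp only [norm_one]
    cases M with
    | zero => exact fun x => by simp
    | succ M =>
      refine ⟨fun x => by simp, fun d _ => ?_⟩
      have : dirDeriv d (fun _ : X => (1 : ℂ)) = fun _ => 0 := by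
        funext x
        simp [dirDeriv]
      rw [this]
      exact hz M
  | succ N ih =>
    obtain ⟨C, hC, h⟩ := ih
    obtain ⟨C', hC', h'⟩ := DerivBound.invFactor (D := D) M
    refine ⟨2 ^ M * (C' * C), ?_, fun L hL hl => ?_⟩
    · have := one_le_pow₀ (M₀ := ℝ) (a := 2) (by norm_num) (n := M)
      exact one_le_mul_of_one_le_of_one_le this (one_le_mul_of_one_le_of_one_le hC' hC)
    · obtain ⟨l, L, rfl⟩ := List.exists_cons_of_length_eq_add_one hL
      have hb := DerivBound.mul (by linarith) (by linarith) (fun x => norm_nonneg _)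
        (fun x => norm_nonneg _) (contDiff_invFactor l) (contDiff_invFactorProd L)
        (h' l (hl l List.mem_cons_self))
        (h L (by simpa using hL) fun l' hl' => hl l' (List.mem_cons_of_mem _ hl'))
      simpa [_root_.invFactorProd] using! hb

end DirectionalDerivatives

/-- The composition of directional derivatives along a list of directions. -/
noncomputable def dirDerivList {X : Type*} [NormedAddCommGroup X] [NormedSpace ℝ X]
    (L : List X) (f : X → ℂ) : X → ℂ := L.foldr dirDeriv f

/-- The list in which each `v j` occurs `A j` times, in the order of the list `l`. -/
def multiList {X ι : Type*} (v : ι → X) (A : ι → ℕ) (l : List ι) : List X :=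
  l.flatMap fun j => List.replicate (A j) (v j)

lemma multiList_add_single {X ι : Type*} [DecidableEq ι] (v : ι → X) (A : ι → ℕ)
    {l : List ι} (hl : l.Nodup) {j : ι} (hj : j ∈ l) :
    (multiList v (A + Pi.single j 1) l).Perm (v j :: multiList v A l) := by
  induction l with
  | nil => simp at hj
  | cons k l ih =>
    rw [List.nodup_cons] at hl
    simp only [multiList, List.flatMap_cons]
    by_cases hk : k = j
    · subst hk
      have : l.flatMap (fun i => List.replicate ((A + Pi.single k 1 : ι → ℕ) i) (v i))
          = l.flatMap fun i => List.replicate (A i) (v i) := by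
        refine List.flatMap_congr fun i hi => ?_
        have : i ≠ k := fun h => hl.1 (h ▸ hi)
        simp [this]
      rw [this]
      simp [List.replicate_succ]
    · have hj' : j ∈ l := by
        rcases List.mem_cons.1 hj with h | h
        · exact absurd h.symm hk
        · exact h
      have e : (A + Pi.single j 1 : ι → ℕ) k = A k := by simp [hk]
      rw [e]
      exact ((ih hl.2 hj').append_left _).trans List.perm_middle

section MixedPartials

variable {X : Type*} [NormedAddCommGroup X] [NormedSpace ℝ X]

lemma contDiff_dirDerivList {f : X → ℂ} (hf : ContDiff ℝ (⊤ : ℕ∞) f) (L : List X) :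
    ContDiff ℝ (⊤ : ℕ∞) (dirDerivList L f) := by
  induction L with
  | nil => exact hf
  | cons d L ih => exact contDiff_dirDeriv ih d

lemma dirDerivList_append (L L' : List X) (f : X → ℂ) :
    dirDerivList (L ++ L') f = dirDerivList L (dirDerivList L' f) := by
  simp [dirDerivList]

lemma dirDeriv_comm {f : X → ℂ} (hf : ContDiff ℝ (⊤ : ℕ∞) f) (d e : X) :
    dirDeriv d (dirDeriv e f) = dirDeriv e (dirDeriv d f) := by
  funext x
  have hd : DifferentiableAt ℝ (fderiv ℝ f) x :=
    (hf.fderiv_right (m := (⊤ : ℕ∞)) (by simp)).differentiable (by simp) x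
  have key : ∀ d e : X, dirDeriv d (dirDeriv e f) x = fderiv ℝ (fderiv ℝ f) x d e := by
    intro d e
    have h := congrArg (fun l : X →L[ℝ] ℂ => l d)
      (fderiv_clm_apply hd (differentiableAt_const e))
    simpa [dirDeriv] using! h
  rw [key, key]
  have h2 : minSmoothness ℝ 2 ≤ ((⊤ : ℕ∞) : WithTop ℕ∞) := by
    simpa using WithTop.coe_le_coe.2 (le_top : (2 : ℕ∞) ≤ ⊤)
  exact hf.contDiffAt.isSymmSndFDerivAt h2 d e

lemma dirDerivList_perm {L L' : List X} (h : L.Perm L') {f : X → ℂ}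
    (hf : ContDiff ℝ (⊤ : ℕ∞) f) : dirDerivList L f = dirDerivList L' f := by
  induction h with
  | nil => rfl
  | cons d _ ih => exact congrArg (dirDeriv d) ih
  | swap d e l => exact dirDeriv_comm (contDiff_dirDerivList hf l) e d
  | trans _ _ ih₁ ih₂ => exact ih₁.trans ih₂

lemma DerivBound.of_dirDerivList {D : Set X} {S : ℝ} {M : ℕ} {f : X → ℂ}
    (h : ∀ L : List X, (∀ d ∈ L, d ∈ D) → L.length ≤ M → ∀ x, ‖dirDerivList L f x‖ ≤ S) :
    DerivBound D (fun _ => 1) S M f := by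
  induction M generalizing f with
  | zero => exact fun x => by simpa using! h [] (by simp) (by simp) x
  | succ M ih =>
    refine ⟨fun x => by simpa using! h [] (by simp) (by simp) x, fun d hd => ih ?_⟩
    intro L hL hM x
    have h' := h (L ++ [d]) (by
      intro e he
      rcases List.mem_append.1 he with he | he
      · exact hL e he
      · rwa [List.mem_singleton.1 he]) (by simpa using hM) x
    rwa [dirDerivList_append] at h'

/-- Differentiating along the image of the coordinate directions under an affine map amounts to
taking partial derivatives of the restriction. -/
lemma dirDerivList_multiList_comp {n : ℕ} (T : Vec n →L[ℝ] X) (p : X) (A : Fin n → ℕ)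
    {F : X → ℂ} (hF : ContDiff ℝ (⊤ : ℕ∞) F) (y : Vec n) :
    dirDerivList (multiList (fun j => T (Pi.single j 1)) A (List.finRange n)) F (p + T y)
      = mpd A (fun y => F (p + T y)) y := by
  have step : ∀ (j : Fin n) (G : X → ℂ), ContDiff ℝ (⊤ : ℕ∞) G →
      pdC j (fun y => G (p + T y)) = fun y => dirDeriv (T (Pi.single j 1)) G (p + T y) := by
    intro j G hG
    funext y
    have h := ((hG.differentiable (by simp) (p + T y)).hasFDerivAt.comp y
      (T.hasFDerivAt.const_add p)).fderiv
    simp only [pdC, dirDeriv]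
    exact (congrArg (fun l : Vec n →L[ℝ] ℂ => l (Pi.single j 1)) h)
  have iter : ∀ (j : Fin n) (k : ℕ) (G : X → ℂ), ContDiff ℝ (⊤ : ℕ∞) G →
      (pdC j)^[k] (fun y => G (p + T y))
        = fun y => dirDerivList (List.replicate k (T (Pi.single j 1))) G (p + T y) := by
    intro j k G hG
    induction k with
    | zero => rfl
    | succ k ih =>
      rw [Function.iterate_succ_apply', ih, step j _ (contDiff_dirDerivList hG _)]
      rfl
  have main : ∀ l : List (Fin n),
      l.foldr (fun i g => (pdC i)^[A i] g) (fun y => F (p + T y))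
        = fun y => dirDerivList (multiList (fun j => T (Pi.single j 1)) A l) F (p + T y) := by
    intro l
    induction l with
    | nil => rfl
    | cons j l ih =>
      rw [List.foldr_cons, ih, iter j (A j) _ (contDiff_dirDerivList hF _)]
      funext y
      have h : multiList (fun j => T (Pi.single j 1)) A (j :: l)
          = List.replicate (A j) (T (Pi.single j 1))
            ++ multiList (fun j => T (Pi.single j 1)) A l := by
        simp [multiList]
      rw [h, dirDerivList_append]
  exact (congrFun (main (List.finRange n)) y).symm

end MixedPartials

section Bisymbols

variable {n : ℕ}

/-- The embedding of the first factor of `ℝ³ⁿ`. -/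
noncomputable def emb₁ (n : ℕ) : Vec n →L[ℝ] Vec n × Vec n × Vec n :=
  ContinuousLinearMap.inl ℝ (Vec n) (Vec n × Vec n)

/-- The embedding of the second factor of `ℝ³ⁿ`. -/
noncomputable def emb₂ (n : ℕ) : Vec n →L[ℝ] Vec n × Vec n × Vec n :=
  (ContinuousLinearMap.inr ℝ (Vec n) (Vec n × Vec n)).comp
    (ContinuousLinearMap.inl ℝ (Vec n) (Vec n))

/-- The embedding of the third factor of `ℝ³ⁿ`. -/
noncomputable def emb₃ (n : ℕ) : Vec n →L[ℝ] Vec n × Vec n × Vec n :=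
  (ContinuousLinearMap.inr ℝ (Vec n) (Vec n × Vec n)).comp
    (ContinuousLinearMap.inr ℝ (Vec n) (Vec n))

@[simp] lemma emb₁_apply (v : Vec n) : emb₁ n v = (v, 0, 0) := rfl

@[simp] lemma emb₂_apply (v : Vec n) : emb₂ n v = (0, v, 0) := rfl

@[simp] lemma emb₃_apply (v : Vec n) : emb₃ n v = (0, 0, v) := rfl

/-- The coordinate directions of `ℝ³ⁿ`. -/
def coordDirs (n : ℕ) : Set (Vec n × Vec n × Vec n) :=
  {d | ∃ j : Fin n, d = emb₁ n (Pi.single j 1) ∨ d = emb₂ n (Pi.single j 1) ∨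
    d = emb₃ n (Pi.single j 1)}

lemma dirDerivList_eq_bisymbol_deriv {a : Vec n → Vec n → Vec n → ℂ}
    (ha : ContDiff ℝ (⊤ : ℕ∞) (fun x : Vec n × Vec n × Vec n => a x.1 x.2.1 x.2.2))
    (A B A' : Fin n → ℕ) (q p q' : Vec n) :
    dirDerivList (multiList (fun j => emb₁ n (Pi.single j 1)) A (List.finRange n) ++
        (multiList (fun j => emb₂ n (Pi.single j 1)) B (List.finRange n) ++
          multiList (fun j => emb₃ n (Pi.single j 1)) A' (List.finRange n)))
      (fun x : Vec n × Vec n × Vec n => a x.1 x.2.1 x.2.2) (q, p, q')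
      = d1B A (d2B B (d3B A' a)) q p q' := by
  rw [dirDerivList_append, dirDerivList_append]
  have h3 : ∀ q p q' : Vec n,
      dirDerivList (multiList (fun j => emb₃ n (Pi.single j 1)) A' (List.finRange n))
        (fun x : Vec n × Vec n × Vec n => a x.1 x.2.1 x.2.2) (q, p, q') = d3B A' a q p q' := by
    intro q p q'
    have := dirDerivList_multiList_comp (emb₃ n) (q, p, 0) A' ha q'
    simpa [d3B] using this
  have s3 := contDiff_dirDerivList ha
    (multiList (fun j => emb₃ n (Pi.single j 1)) A' (List.finRange n))
  have h2 : ∀ q p q' : Vec n,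
      dirDerivList (multiList (fun j => emb₂ n (Pi.single j 1)) B (List.finRange n))
        (dirDerivList (multiList (fun j => emb₃ n (Pi.single j 1)) A' (List.finRange n))
        (fun x : Vec n × Vec n × Vec n => a x.1 x.2.1 x.2.2)) (q, p, q')
        = d2B B (d3B A' a) q p q' := by
    intro q p q'
    have := dirDerivList_multiList_comp (emb₂ n) (q, 0, q') B s3 p
    simp only [emb₂_apply, Prod.mk_add_mk, add_zero, zero_add, h3] at this
    simpa [d2B] using this
  have s2 := contDiff_dirDerivList s3
    (multiList (fun j => emb₂ n (Pi.single j 1)) B (List.finRange n))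
  have := dirDerivList_multiList_comp (emb₁ n) (0, p, q') A s2 q
  simp only [emb₁_apply, Prod.mk_add_mk, add_zero, zero_add, h2] at this
  simpa [d1B] using this

lemma exists_perm_multiList (L : List (Vec n × Vec n × Vec n)) (hL : ∀ d ∈ L, d ∈ coordDirs n) :
    ∃ A B A' : Fin n → ℕ, fullLen A + fullLen B + fullLen A' = L.length ∧
      L.Perm (multiList (fun j => emb₁ n (Pi.single j 1)) A (List.finRange n) ++
        (multiList (fun j => emb₂ n (Pi.single j 1)) B (List.finRange n) ++
          multiList (fun j => emb₃ n (Pi.single j 1)) A' (List.finRange n))) := by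
  have hs : ∀ (A : Fin n → ℕ) (j : Fin n), fullLen (A + Pi.single j 1) = fullLen A + 1 := by
    intro A j
    simp [fullLen, Finset.sum_add_distrib]
  induction L with
  | nil => exact ⟨0, 0, 0, by simp [fullLen], by simp [multiList]⟩
  | cons d L ih =>
    obtain ⟨A, B, A', hlen, hp⟩ := ih fun e he => hL e (List.mem_cons_of_mem _ he)
    obtain ⟨j, hj⟩ := hL d List.mem_cons_self
    have hnd := List.nodup_finRange n
    have hm := List.mem_finRange j
    rcases hj with rfl | rfl | rfl
    · refine ⟨A + Pi.single j 1, B, A', by rw [hs, List.length_cons]; omega, ?_⟩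
      exact (hp.cons _).trans
        ((multiList_add_single (fun j => emb₁ n (Pi.single j 1)) A hnd hm).symm.append_right _)
    · refine ⟨A, B + Pi.single j 1, A', by rw [hs, List.length_cons]; omega, ?_⟩
      exact ((hp.cons _).trans List.perm_middle.symm).trans
        (((multiList_add_single (fun j => emb₂ n (Pi.single j 1)) B hnd hm).symm.append_right
          _).append_left _)
    · refine ⟨A, B, A' + Pi.single j 1, by rw [hs, List.length_cons]; omega, ?_⟩
      refine ((hp.cons _).trans List.perm_middle.symm).trans (List.Perm.append_left _ ?_)
      exact List.perm_middle.symm.trans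
        ((multiList_add_single (fun j => emb₃ n (Pi.single j 1)) A' hnd hm).symm.append_left _)

lemma norm_bisymbol_deriv_le [NeZero n] {a : Vec n → Vec n → Vec n → ℂ}
    (ha : IsBisymbolOne 0 0 a) {M : ℕ} {A B A' : Fin n → ℕ}
    (hM : fullLen A + fullLen B + fullLen A' ≤ M) (q p q' : Vec n) :
    ‖d1B A (d2B B (d3B A' a)) q p q'‖ ≤ bisymSeminormOne M 0 0 a := by
  have hle : ∀ (E : Fin n → ℕ), fullLen E ≤ M → ∀ i, E i < M + 1 := fun E hE i =>
    Nat.lt_succ_of_le ((Finset.single_le_sum (f := E) (fun _ _ => Nat.zero_le _)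
      (Finset.mem_univ i)).trans hE)
  set EA : Fin n → Fin (M + 1) := fun i => ⟨A i, hle A (by omega) i⟩
  set EB : Fin n → Fin (M + 1) := fun i => ⟨B i, hle B (by omega) i⟩
  set EA' : Fin n → Fin (M + 1) := fun i => ⟨A' i, hle A' (by omega) i⟩
  simp only [bisymSeminormOne, neg_zero, zero_mul, add_zero, Real.rpow_zero, one_mul]
  set t : (Fin n → Fin (M + 1)) → (Fin n → Fin (M + 1)) → (Fin n → Fin (M + 1)) → ℝ :=
    fun A B A' => if fullLen (fun i => (A i : ℕ)) + fullLen (fun i => (B i : ℕ))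
        + fullLen (fun i => (A' i : ℕ)) ≤ M then
      ⨆ q : Vec n, ⨆ p : Vec n, ⨆ q' : Vec n, ‖d1B (fun i => (A i : ℕ))
        (d2B (fun i => (B i : ℕ)) (d3B (fun i => (A' i : ℕ)) a)) q p q'‖ else 0 with ht
  have h0 : ∀ A B A', 0 ≤ t A B A' := by
    intro A B A'
    simp only [ht]
    split_ifs
    · exact Real.iSup_nonneg fun _ => Real.iSup_nonneg fun _ => Real.iSup_nonneg fun _ =>
        norm_nonneg _
    · exact le_rfl
  have h1 : t EA EB EA' ≤ ∑ A, ∑ B, ∑ A', t A B A' := by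
    refine le_trans ?_ (Finset.single_le_sum (f := fun A => ∑ B, ∑ A', t A B A')
      (fun A _ => Finset.sum_nonneg fun B _ => Finset.sum_nonneg fun A' _ => h0 A B A')
      (Finset.mem_univ EA))
    refine le_trans ?_ (Finset.single_le_sum (f := fun B => ∑ A', t EA B A')
      (fun B _ => Finset.sum_nonneg fun A' _ => h0 EA B A') (Finset.mem_univ EB))
    exact Finset.single_le_sum (f := fun A' => t EA EB A') (fun A' _ => h0 EA EB A')
      (Finset.mem_univ EA')
  refine le_trans ?_ h1
  have e : t EA EB EA' = ⨆ q : Vec n, ⨆ p : Vec n, ⨆ q' : Vec n,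
      ‖d1B A (d2B B (d3B A' a)) q p q'‖ := if_pos hM
  rw [e]
  obtain ⟨C, hC, hb⟩ := ha.2 A B A'
  simp only [zero_mul, sub_zero, Real.rpow_zero, mul_one] at hb
  have b3 : ∀ q p, BddAbove (Set.range fun q' => ‖d1B A (d2B B (d3B A' a)) q p q'‖) :=
    fun q p => ⟨C, by rintro _ ⟨q', rfl⟩; exact hb q p q'⟩
  have b2 : ∀ q, BddAbove (Set.range fun p => ⨆ q', ‖d1B A (d2B B (d3B A' a)) q p q'‖) :=
    fun q => ⟨C, by rintro _ ⟨p, rfl⟩; exact ciSup_le (hb q p)⟩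
  have b1 : BddAbove (Set.range fun q => ⨆ p, ⨆ q', ‖d1B A (d2B B (d3B A' a)) q p q'‖) :=
    ⟨C, by rintro _ ⟨q, rfl⟩; exact ciSup_le fun p => ciSup_le (hb q p)⟩
  exact (le_ciSup (b3 q p) q').trans ((le_ciSup (b2 q) p).trans (le_ciSup b1 q))

lemma derivBound_of_isBisymbolOne [NeZero n] {a : Vec n → Vec n → Vec n → ℂ}
    (ha : IsBisymbolOne 0 0 a) (M : ℕ) :
    DerivBound (coordDirs n) (fun _ => 1) (bisymSeminormOne M 0 0 a) M
      (fun x : Vec n × Vec n × Vec n => a x.1 x.2.1 x.2.2) := by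
  refine DerivBound.of_dirDerivList fun L hL hM x => ?_
  obtain ⟨A, B, A', hlen, hp⟩ := exists_perm_multiList L hL
  rw [dirDerivList_perm hp ha.1]
  obtain ⟨q, p, q'⟩ := x
  rw [dirDerivList_eq_bisymbol_deriv ha.1]
  exact norm_bisymbol_deriv_le ha (by omega) q p q'

end Bisymbols

/-- The function equal to `exp (-t)` for `t > 0` and to `0` for `t ≤ 0`. -/
noncomputable def expKer (t : ℝ) : ℝ := (Set.Ioi (0 : ℝ)).indicator (fun t => Real.exp (-t)) t

/-- The tensor product of the functions `expKer`. -/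
noncomputable def expKerProd {N : ℕ} (t : Fin N → ℝ) : ℝ := ∏ j, expKer (t j)

section ExponentialKernel

lemma expKer_nonneg (t : ℝ) : 0 ≤ expKer t :=
  Set.indicator_nonneg (fun _ _ => (Real.exp_pos _).le) t

lemma expKer_le_one (t : ℝ) : expKer t ≤ 1 :=
  Set.indicator_le' (fun s (hs : 0 < s) => Real.exp_le_one_iff.2 (by linarith))
    (fun _ _ => zero_le_one) t

lemma measurable_expKer : Measurable expKer :=
  (by fun_prop : Measurable fun t : ℝ => Real.exp (-t)).indicator measurableSet_Ioi

lemma integrable_expKer : Integrable expKer := by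
  have h : IntegrableOn (fun t : ℝ => Real.exp (-t)) (Set.Ioi 0) := by
    simpa using! exp_neg_integrableOn_Ioi 0 one_pos
  exact h.integrable_indicator measurableSet_Ioi

variable {N : ℕ}

lemma expKerProd_nonneg (t : Fin N → ℝ) : 0 ≤ expKerProd t :=
  Finset.prod_nonneg fun _ _ => expKer_nonneg _

lemma expKerProd_le_one (t : Fin N → ℝ) : expKerProd t ≤ 1 :=
  Finset.prod_le_one (fun _ _ => expKer_nonneg _) fun _ _ => expKer_le_one _

lemma measurable_expKerProd : Measurable (expKerProd : (Fin N → ℝ) → ℝ) :=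
  Finset.measurable_prod _ fun j _ => measurable_expKer.comp (measurable_pi_apply j)

lemma integrable_expKerProd : Integrable (expKerProd : (Fin N → ℝ) → ℝ) :=
  Integrable.fintype_prod (f := fun _ => expKer) fun _ => integrable_expKer

variable {X : Type*} [NormedAddCommGroup X] [NormedSpace ℝ X]

lemma integral_expKer_mul_dirOp {f : X → ℂ} (hf : ContDiff ℝ (⊤ : ℕ∞) f) {d : X} {S : ℝ}
    (b0 : ∀ x, ‖f x‖ ≤ S) (b1 : ∀ x, ‖dirOp d f x‖ ≤ S) (x : X) :
    ∫ s : ℝ, (expKer s : ℂ) * dirOp d f (x - s • d) = f x := by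
  have hcont : Continuous fun s : ℝ => dirOp d f (x - s • d) :=
    (contDiff_dirOp hf d).continuous.comp (by fun_prop)
  have e : (fun s : ℝ => (expKer s : ℂ) * dirOp d f (x - s • d))
      = (Set.Ioi (0 : ℝ)).indicator fun s => (Real.exp (-s) : ℂ) * dirOp d f (x - s • d) := by
    funext s
    by_cases hs : s ∈ Set.Ioi (0 : ℝ) <;> simp [expKer, hs]
  have hint : IntegrableOn (fun s : ℝ => (Real.exp (-s) : ℂ) * dirOp d f (x - s • d))
      (Set.Ioi 0) := by
    have h : IntegrableOn (fun t : ℝ => Real.exp (-t)) (Set.Ioi 0) := by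
      simpa using! exp_neg_integrableOn_Ioi 0 one_pos
    refine Integrable.mono' (h.const_mul S) (by fun_prop) (Filter.Eventually.of_forall fun s => ?_)
    rw [norm_mul, mul_comm S, Complex.norm_real, Real.norm_of_nonneg (Real.exp_pos _).le]
    exact mul_le_mul_of_nonneg_left (b1 _) (Real.exp_pos _).le
  have hderiv : ∀ s ∈ Set.Ici (0 : ℝ), HasDerivAt
      (fun s : ℝ => -((Real.exp (-s) : ℂ) * f (x - s • d)))
      ((Real.exp (-s) : ℂ) * dirOp d f (x - s • d)) s := by
    intro s _
    have h1 : HasDerivAt (fun s : ℝ => ((Real.exp (-s) : ℝ) : ℂ)) ((-Real.exp (-s) : ℝ) : ℂ) s := by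
      have := ((hasDerivAt_neg s).exp).ofReal_comp
      simpa using! this
    have h2 : HasDerivAt (fun s : ℝ => x - s • d) (-d) s := by
      simpa using ((hasDerivAt_id s).smul_const d).const_sub x
    have h3 := (hf.differentiable (by simp) (x - s • d)).hasFDerivAt.comp_hasDerivAt s h2
    refine (h1.mul h3).neg.congr_deriv ?_
    simp [dirOp]
    ring
  have hlim : Filter.Tendsto (fun s : ℝ => -((Real.exp (-s) : ℂ) * f (x - s • d)))
      Filter.atTop (nhds 0) := by
    refine squeeze_zero_norm (a := fun s : ℝ => Real.exp (-s) * S) (fun s => ?_) ?_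
    · rw [norm_neg, norm_mul, Complex.norm_real, Real.norm_of_nonneg (Real.exp_pos _).le]
      exact mul_le_mul_of_nonneg_left (b0 _) (Real.exp_pos _).le
    · simpa only [zero_mul] using Real.tendsto_exp_neg_atTop_nhds_zero.mul_const S
  rw [e, integral_indicator measurableSet_Ioi,
    integral_Ioi_of_hasDerivAt_of_tendsto' hderiv hint hlim]
  simp

lemma integral_expKerProd_mul_dirOpList {D : Set X} {S : ℝ} {f : X → ℂ}
    (hf : ContDiff ℝ (⊤ : ℕ∞) f) {d : Fin N → X} (hd : ∀ j, d j ∈ D)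
    (bf : DerivBound D (fun _ => 1) S N f) (x : X) :
    ∫ t : Fin N → ℝ, (expKerProd t : ℂ) * dirOpList (List.ofFn d) f (x - ∑ j, t j • d j)
      = f x := by
  induction N generalizing f S x with
  | zero => simp [expKerProd, dirOpList, volume_pi, Measure.pi_of_empty _ (0 : Fin 0 → ℝ)]
  | succ N ih =>
    have bf1 := bf.dirOp hf (Or.inl (hd 0))
    have hlast : ∀ x, ‖dirOpList (List.ofFn d) f x‖ ≤ 2 ^ (N + 1) * S := fun x => by
      have h := DerivBound.dirOpList (M := 0) (L := List.ofFn d) hf (fun e he => by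
        obtain ⟨j, rfl⟩ := (List.mem_ofFn' d e).1 he
        exact Or.inl (hd j)) (by simpa using! bf)
      simpa using h.norm_le x
    have hcons : dirOpList (List.ofFn d) f
        = dirOpList (List.ofFn fun j : Fin N => d j.succ) (dirOp (d 0) f) := by
      simp [dirOpList, List.ofFn_succ]
    have hcont := (contDiff_dirOpList hf (List.ofFn d)).continuous
    set e := (MeasurableEquiv.piFinSuccAbove (fun _ : Fin (N + 1) => ℝ) 0).symm with he
    have hmp : MeasurePreserving e :=
      (volume_preserving_piFinSuccAbove (fun _ : Fin (N + 1) => ℝ) 0).symm _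
    set Φ : (Fin (N + 1) → ℝ) → ℂ := fun t =>
      (expKerProd t : ℂ) * dirOpList (List.ofFn d) f (x - ∑ j, t j • d j) with hΦ
    have hΦi : Integrable Φ := by
      refine Integrable.mono' (integrable_expKerProd.const_mul (2 ^ (N + 1) * S)) ?_
        (Filter.Eventually.of_forall fun t => ?_)
      · refine (Complex.measurable_ofReal.comp measurable_expKerProd).aestronglyMeasurable.mul ?_
        exact (hcont.comp (by fun_prop)).aestronglyMeasurable
      · rw [norm_mul, mul_comm (2 ^ (N + 1) * S), Complex.norm_real,
          Real.norm_of_nonneg (expKerProd_nonneg t)]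
        exact mul_le_mul_of_nonneg_left (hlast _) (expKerProd_nonneg t)
    have hΦe : ∀ p : ℝ × (Fin N → ℝ), Φ (e p) = (expKer p.1 : ℂ) * ((expKerProd p.2 : ℂ) *
        dirOpList (List.ofFn fun j : Fin N => d j.succ) (dirOp (d 0) f)
          ((x - p.1 • d 0) - ∑ j, p.2 j • d j.succ)) := by
      intro p
      have h0 : e p 0 = p.1 := by simp [he, MeasurableEquiv.piFinSuccAbove_symm_apply]
      have h1 : ∀ j : Fin N, e p j.succ = p.2 j := fun j => by
        simp [he, MeasurableEquiv.piFinSuccAbove_symm_apply]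
      simp only [hΦ, hcons, expKerProd, Fin.prod_univ_succ, Fin.sum_univ_succ, h0, h1]
      push_cast
      rw [mul_assoc, sub_sub]
    rw [← hmp.integral_comp e.measurableEmbedding Φ,
      Measure.volume_eq_prod, integral_prod _ (by
        exact (hmp.integrable_comp_emb e.measurableEmbedding).2 hΦi)]
    simp_rw [hΦe, integral_const_mul]
    rw [← integral_expKer_mul_dirOp hf (d := d 0) (S := max S (2 * S))
      (fun y => le_max_of_le_left (by simpa using bf.norm_le y))
      (fun y => le_max_of_le_right (by simpa using bf1.norm_le y)) x]
    refine integral_congr_ae (Filter.Eventually.of_forall fun s => ?_)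
    simp only
    rw [ih (contDiff_dirOp hf (d 0)) (fun j => hd j.succ) bf1]

end ExponentialKernel

section Plancherel

open FourierTransform SchwartzMap
open scoped RealInnerProductSpace

lemma eLpNorm_fourier_of_integrable {E : Type*} [NormedAddCommGroup E] [InnerProductSpace ℝ E]
    [FiniteDimensional ℝ E] [MeasurableSpace E] [BorelSpace E] {f : E → ℂ}
    (h1 : Integrable f) (h2 : MemLp f 2) : eLpNorm (𝓕 f) 2 = eLpNorm f 2 := by
  set F := h2.toLp f with hF
  have hcont : Continuous (𝓕 f) :=
    VectorFourier.fourierIntegral_continuous (L := innerₗ E) Real.continuous_fourierChar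
      (by exact continuous_inner) h1
  have key : 𝓕 f =ᵐ[volume] (𝓕 F : Lp ℂ 2 (volume : Measure E)) := by
    refine ae_eq_of_integral_contDiff_smul_eq hcont.locallyIntegrable
      ((Lp.memLp _).locallyIntegrable (by norm_num)) fun g hg hgs => ?_
    have hgc : ContDiff ℝ (⊤ : ℕ∞) fun x => (g x : ℂ) := Complex.ofRealCLM.contDiff.comp hg
    have hgsc : HasCompactSupport fun x => (g x : ℂ) := hgs.comp_left (g := fun x : ℝ => (x : ℂ)) rfl
    set G := hgsc.toSchwartzMap hgc with hG
    have hGe : ∀ x, G x = (g x : ℂ) := fun x => rfl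
    have e1 := congrArg (fun T : 𝓢'(E, ℂ) => T G) (Lp.fourier_toTemperedDistribution_eq F)
    simp only [TemperedDistribution.fourier_apply, Lp.toTemperedDistribution_apply, hGe] at e1
    have e2 : ∫ x, (𝓕 G) x • F x = ∫ x, (𝓕 G) x • f x := by
      refine integral_congr_ae ?_
      filter_upwards [h2.coeFn_toLp] with x hx
      rw [hF, hx]
    have e3 := VectorFourier.integral_fourierIntegral_smul_eq_flip (μ := volume) (ν := volume)
      (L := innerₗ E) (f := G) (g := f) Real.continuous_fourierChar (by exact continuous_inner)
      G.integrable h1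
    rw [flip_innerₗ] at e3
    have e4 : ∫ x, (𝓕 G) x • f x = ∫ x, G x • 𝓕 f x := e3
    have e5 : ∫ x, g x • 𝓕 f x = ∫ x, G x • 𝓕 f x := rfl
    have e6 : ∫ x, g x • (𝓕 F : Lp ℂ 2 (volume : Measure E)) x
      = ∫ x, (g x : ℂ) • (𝓕 F : Lp ℂ 2 (volume : Measure E)) x := rfl
    rw [e6, ← e1, e2, e4, e5]
  rw [eLpNorm_congr_ae key, ← eLpNorm_congr_ae h2.coeFn_toLp, ← hF]
  have := Lp.norm_fourier_eq F
  rw [Lp.norm_def, Lp.norm_def] at this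
  exact (ENNReal.toReal_eq_toReal_iff' (Lp.eLpNorm_ne_top _) (Lp.eLpNorm_ne_top _)).1 this

lemma lintegral_comp_const_smul {N : ℕ} {r : ℝ} (hr : 0 < r) (g : (Fin N → ℝ) → ENNReal) :
    ∫⁻ x, g x = ENNReal.ofReal (r ^ N) * ∫⁻ x, g (r • x) := by
  have h := Measure.map_addHaar_smul (volume : Measure (Fin N → ℝ)) hr.ne'
  have e : ∫⁻ x, g (r • x) = ∫⁻ x, g x ∂(Measure.map (r • ·) (volume : Measure (Fin N → ℝ))) :=
    ((Homeomorph.smulOfNeZero r hr.ne').measurableEmbedding.lintegral_map g).symm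
  rw [e, h, lintegral_smul_measure, Module.finrank_fin_fun, abs_of_pos (by positivity),
    smul_eq_mul, ← mul_assoc, ← ENNReal.ofReal_mul (by positivity),
    mul_inv_cancel₀ (by positivity)]
  simp

lemma lintegral_enorm_fourier_phase {n : ℕ} {f : Vec n → ℂ} (h1 : Integrable f)
    (h2 : MemLp f 2) :
    ∫⁻ ξ, ‖∫ y, phase ξ 0 y * f y‖ₑ ^ 2 = ENNReal.ofReal ((2 * π) ^ n) * ∫⁻ y, ‖f y‖ₑ ^ 2 := by
  have hof := PiLp.volume_preserving_ofLp (Fin n)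
  have hto := PiLp.volume_preserving_toLp (Fin n)
  have hme : MeasurableEmbedding (WithLp.toLp 2 : (Fin n → ℝ) → _) :=
    (MeasurableEquiv.toLp 2 (Fin n → ℝ)).measurableEmbedding
  set g : EuclideanSpace ℝ (Fin n) → ℂ := fun y => f (WithLp.ofLp y) with hg
  have g1 : Integrable g := hof.integrable_comp_of_integrable h1
  have g2 : MemLp g 2 := h2.comp_measurePreserving hof
  have h := eLpNorm_fourier_of_integrable g1 g2
  have hsq : ∀ k : EuclideanSpace ℝ (Fin n) → ℂ, ∫⁻ y, ‖k y‖ₑ ^ 2 = eLpNorm k 2 ^ 2 := by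
    intro k
    have := eLpNorm_nnreal_pow_eq_lintegral (μ := volume) (f := k) (p := 2) (by norm_num)
    simpa using this.symm
  have hF : ∀ x : Vec n, 𝓕 g (WithLp.toLp 2 x) = ∫ y, phase ((2 * π) • x) 0 y * f y := by
    intro x
    rw [Real.fourier_eq', ← hto.integral_comp hme]
    refine integral_congr_ae (Filter.Eventually.of_forall fun y => ?_)
    simp only [hg, phase, smul_eq_mul]
    congr 2
    rw [mul_comm, EuclideanSpace.inner_eq_star_dotProduct]
    congr 2
    simp [dotProduct, Finset.mul_sum, mul_assoc]
  rw [lintegral_comp_const_smul (r := 2 * π) (by positivity)]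
  simp_rw [← hF]
  rw [hto.lintegral_comp_emb hme (fun ξ => ‖𝓕 g ξ‖ₑ ^ 2), hsq, h, ← hsq,
    ← hto.lintegral_comp_emb hme]

end Plancherel

section Phase

variable {n : ℕ}

lemma norm_phase (p q q' : Vec n) : ‖phase p q q'‖ = 1 := by
  rw [phase, mul_comm, Complex.norm_exp_ofReal_mul_I]

lemma contDiff_phase :
    ContDiff ℝ (⊤ : ℕ∞) fun x : Vec n × Vec n × Vec n => phase x.2.1 x.1 x.2.2 := by
  unfold phase
  have h : ContDiff ℝ (⊤ : ℕ∞) fun x : Vec n × Vec n × Vec n =>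
      ∑ i, x.2.1 i * (x.1 i - x.2.2 i) := ContDiff.sum fun i _ => by fun_prop
  exact (contDiff_const.mul (Complex.ofRealCLM.contDiff.comp h)).cexp

lemma continuous_phase :
    Continuous fun x : Vec n × Vec n × Vec n => phase x.2.1 x.1 x.2.2 :=
  contDiff_phase.continuous

lemma phase_sub (p q q' : Vec n) : phase p q q' = phase p q 0 * phase p 0 q' := by
  simp only [phase, ← Complex.exp_add, ← mul_add, ← Complex.ofReal_add, ← Finset.sum_add_distrib]
  congr 3
  refine Finset.sum_congr rfl fun i _ => ?_
  simp only [Pi.zero_apply]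
  ring

/-- The functional `(q, p, q') ↦ q j - q' j`. -/
noncomputable def diffCoord (j : Fin n) : Vec n × Vec n × Vec n →L[ℝ] ℝ :=
  (ContinuousLinearMap.proj j).comp (ContinuousLinearMap.fst ℝ _ _) -
    (ContinuousLinearMap.proj j).comp
      ((ContinuousLinearMap.snd ℝ _ _).comp (ContinuousLinearMap.snd ℝ _ _))

@[simp] lemma diffCoord_apply (j : Fin n) (x : Vec n × Vec n × Vec n) :
    diffCoord j x = x.1 j - x.2.2 j := rfl

lemma fderiv_phase (p q q' : Vec n) (j : Fin n) :
    fderiv ℝ (fun p => phase p q q') p (Pi.single j 1)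
      = Complex.I * ((q j - q' j : ℝ) : ℂ) * phase p q q' := by
  have h1 : HasFDerivAt (fun p : Vec n => ∑ i, p i * (q i - q' i))
      (∑ i, (q i - q' i) • (ContinuousLinearMap.proj i : Vec n →L[ℝ] ℝ)) p :=
    HasFDerivAt.fun_sum fun i _ =>
      (ContinuousLinearMap.proj i : Vec n →L[ℝ] ℝ).hasFDerivAt.mul_const (q i - q' i)
  have h2 := ((Complex.ofRealCLM.hasFDerivAt.comp p h1).const_mul Complex.I).cexp
  have h3 : fderiv ℝ (fun p => phase p q q') p = _ := h2.fderiv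
  rw [h3]
  simp [phase, Pi.single_apply]
  ring

lemma fderiv_comp_emb₂ {g : Vec n × Vec n × Vec n → ℂ} (hg : ContDiff ℝ (⊤ : ℕ∞) g)
    (q p q' v : Vec n) :
    fderiv ℝ (fun p => g (q, p, q')) p v = fderiv ℝ g (q, p, q') (emb₂ n v) := by
  have h1 : HasFDerivAt (fun p : Vec n => (q, p, q')) (emb₂ n) p := by
    have := (emb₂ n).hasFDerivAt (x := p) |>.const_add (q, 0, q')
    simpa using! this
  have h2 := ((hg.differentiable (by simp) (q, p, q')).hasFDerivAt.comp p h1).fderiv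
  exact congrArg (fun l : Vec n →L[ℝ] ℂ => l v) h2

variable {g : Vec n × Vec n × Vec n → ℂ} {W : Vec n × Vec n × Vec n → ℝ} {S : ℝ}

lemma integrable_mul_phase (hg : Continuous g) (bg : ∀ x, ‖g x‖ ≤ S * W x) {q q' : Vec n}
    (hW : Integrable fun p => W (q, p, q')) :
    Integrable fun p => g (q, p, q') * phase p q q' := by
  refine Integrable.mono' (hW.const_mul S) ?_ (Filter.Eventually.of_forall fun p => ?_)
  · exact ((hg.comp (by fun_prop)).mul
      (continuous_phase.comp (by fun_prop : Continuous fun p => (q, p, q')))).aestronglyMeasurable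
  · rw [norm_mul, norm_phase, mul_one]
    exact bg _

lemma integral_mul_phase_eq_invFactor (hg : ContDiff ℝ (⊤ : ℕ∞) g)
    (bg : DerivBound (coordDirs n) W S 1 g) {q q' : Vec n}
    (hW : Integrable fun p => W (q, p, q')) (j : Fin n) :
    ∫ p, g (q, p, q') * phase p q q' = invFactor (diffCoord j) (q, 0, q') *
      ∫ p, dirOp (-emb₂ n (Pi.single j 1)) g (q, p, q') * phase p q q' := by
  have hd : emb₂ n (Pi.single j 1) ∈ coordDirs n := ⟨j, Or.inr (Or.inl rfl)⟩
  have i0 := integrable_mul_phase hg.continuous bg.1 hW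
  have i1 : Integrable fun p => fderiv ℝ g (q, p, q') (emb₂ n (Pi.single j 1)) * phase p q q' :=
    integrable_mul_phase (contDiff_dirDeriv hg _).continuous (bg.2 _ hd) hW
  have hp : ContDiff ℝ (⊤ : ℕ∞) fun p => phase p q q' :=
    contDiff_phase.comp (by fun_prop : ContDiff ℝ (⊤ : ℕ∞) fun p => (q, p, q'))
  have ibp := integral_mul_fderiv_eq_neg_fderiv_mul_of_integrable (μ := volume)
    (f := fun p => g (q, p, q')) (g := fun p => phase p q q') (v := Pi.single j 1)
    (by simpa only [fderiv_comp_emb₂ hg] using i1)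
    (by
      simp only [fderiv_phase]
      refine (i0.const_mul (Complex.I * ((q j - q' j : ℝ) : ℂ))).congr
        (Filter.Eventually.of_forall fun p => ?_)
      simp only
      ring)
    i0
    (fun p _ => (hg.comp (by fun_prop : ContDiff ℝ (⊤ : ℕ∞) fun p => (q, p, q'))).differentiable
      (by simp) p)
    (fun p _ => hp.differentiable (by simp) p)
  simp only [fderiv_comp_emb₂ hg, fderiv_phase] at ibp
  have e : ∫ p, dirOp (-emb₂ n (Pi.single j 1)) g (q, p, q') * phase p q q'
      = (1 + Complex.I * ((q j - q' j : ℝ) : ℂ)) * ∫ p, g (q, p, q') * phase p q q' := by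
    simp only [dirOp, map_neg, ← sub_eq_add_neg, sub_mul, add_mul]
    rw [integral_sub i0 i1, sub_eq_add_neg, ← ibp, one_mul, ← integral_const_mul]
    congr 2
    funext p
    ring
  rw [e, ← mul_assoc, invFactor, diffCoord_apply, inv_mul_cancel₀ (one_add_I_mul_ne_zero _),
    one_mul]

lemma integral_mul_phase_eq_invFactorProd (L : List (Fin n)) (hg : ContDiff ℝ (⊤ : ℕ∞) g)
    (bg : DerivBound (coordDirs n) W S L.length g) {q q' : Vec n}
    (hW : Integrable fun p => W (q, p, q')) :
    ∫ p, g (q, p, q') * phase p q q' = invFactorProd (L.map diffCoord) (q, 0, q') *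
      ∫ p, dirOpList (L.map fun j => -emb₂ n (Pi.single j 1)) g (q, p, q') * phase p q q' := by
  induction L generalizing g S with
  | nil => simp [invFactorProd, dirOpList]
  | cons j L ih =>
    have hd : emb₂ n (Pi.single j 1) ∈ coordDirs n := ⟨j, Or.inr (Or.inl rfl)⟩
    rw [integral_mul_phase_eq_invFactor hg (bg.of_le (by simp)) hW j,
      ih (contDiff_dirOp hg _) (bg.dirOp hg (Or.inr (by simpa using hd)))]
    simp only [invFactorProd, List.map_cons, List.prod_cons, mul_assoc]
    rfl

end Phase

section WavePackets

variable {n : ℕ}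

/-- The Fourier transform of `f` localized near `z` by the one-sided exponential kernel. -/
noncomputable def wavePacket (f : Vec n → ℂ) (z p : Vec n) : ℂ :=
  ∫ y, (expKerProd (y - z) : ℂ) * (phase p 0 y * f y)

lemma integrable_expKerProd_sub_mul {g : Vec n → ℂ} (hg : Integrable g) :
    Integrable (fun x : Vec n × Vec n => (expKerProd (x.1 - x.2) : ℂ) * g x.1)
      (volume.prod volume) := by
  have h1 : Integrable fun t : Vec n => (expKerProd (-t) : ℂ) :=
    (integrable_expKerProd (N := n)).comp_neg.ofReal
  have h2 := (hg.convolution_integrand (ContinuousLinearMap.mul ℝ ℂ) h1).swap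
  refine h2.congr (Filter.Eventually.of_forall fun x => ?_)
  simp [mul_comm]

lemma integrable_phase_mul {f : Vec n → ℂ} (hf : Integrable f) (p : Vec n) :
    Integrable fun y => phase p 0 y * f y := by
  refine hf.bdd_mul (c := 1) ?_ (Filter.Eventually.of_forall fun y => (norm_phase _ _ _).le)
  exact (continuous_phase.comp
    (by fun_prop : Continuous fun y : Vec n => ((0 : Vec n), p, y))).aestronglyMeasurable

lemma integrable_wavePacket {f : Vec n → ℂ} (hf : Integrable f) (p : Vec n) :
    Integrable fun z => wavePacket f z p :=
  (integrable_expKerProd_sub_mul (integrable_phase_mul hf p)).integral_prod_right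

lemma integral_mul_integral_expKerProd {g h : Vec n → ℂ} {B : ℝ} (hg : Integrable g)
    (hh : Continuous h) (hB : ∀ z, ‖h z‖ ≤ B) :
    ∫ y, (∫ z, (expKerProd (y - z) : ℂ) * h z) * g y
      = ∫ z, h z * ∫ y, (expKerProd (y - z) : ℂ) * g y := by
  have hi : Integrable (fun x : Vec n × Vec n =>
      h x.2 * ((expKerProd (x.1 - x.2) : ℂ) * g x.1)) (volume.prod volume) :=
    (integrable_expKerProd_sub_mul hg).bdd_mul (c := B)
      (hh.comp continuous_snd).aestronglyMeasurable
      (Filter.Eventually.of_forall fun x => hB x.2)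
  calc ∫ y, (∫ z, (expKerProd (y - z) : ℂ) * h z) * g y
      = ∫ y, ∫ z, h z * ((expKerProd (y - z) : ℂ) * g y) := by
        congr 1
        funext y
        rw [← integral_mul_const]
        congr 1
        funext z
        ring
    _ = ∫ z, ∫ y, h z * ((expKerProd (y - z) : ℂ) * g y) := integral_integral_swap hi
    _ = _ := by simp_rw [integral_const_mul]

lemma stronglyMeasurable_wavePacket {f : Vec n → ℂ} (hf : Measurable f) :
    StronglyMeasurable fun x : Vec n × Vec n => wavePacket f x.1 x.2 := by
  have h : Measurable fun x : (Vec n × Vec n) × Vec n =>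
      (expKerProd (x.2 - x.1.1) : ℂ) * (phase x.1.2 0 x.2 * f x.2) := by
    refine (Complex.measurable_ofReal.comp (measurable_expKerProd.comp (by fun_prop))).mul
      (Measurable.mul ?_ (hf.comp measurable_snd))
    exact (continuous_phase.comp (by fun_prop :
      Continuous fun x : (Vec n × Vec n) × Vec n => ((0 : Vec n), x.1.2, x.2))).measurable
  exact h.stronglyMeasurable.integral_prod_right

lemma lintegral_enorm_wavePacket_le {f : Vec n → ℂ} (hf : Measurable f) (h1 : Integrable f)
    (h2 : MemLp f 2) :
    ∫⁻ p, ∫⁻ z, ‖wavePacket f z p‖ₑ ^ 2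
      ≤ ENNReal.ofReal ((2 * π) ^ n * ∫ t : Vec n, expKerProd t) * ∫⁻ y, ‖f y‖ₑ ^ 2 := by
  have hE : Measurable fun x : Vec n × Vec n => expKerProd (x.1 - x.2) :=
    measurable_expKerProd.comp (by fun_prop)
  have hz : ∀ z : Vec n, ∫⁻ p, ‖wavePacket f z p‖ₑ ^ 2
      = ENNReal.ofReal ((2 * π) ^ n) * ∫⁻ y, ‖(expKerProd (y - z) : ℂ) * f y‖ₑ ^ 2 := by
    intro z
    have hm : AEStronglyMeasurable fun y => (expKerProd (y - z) : ℂ) :=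
      (Complex.measurable_ofReal.comp
        (measurable_expKerProd.comp (by fun_prop))).aestronglyMeasurable
    have hb : ∀ y : Vec n, ‖(expKerProd (y - z) : ℂ)‖ ≤ 1 := fun y => by
      rw [Complex.norm_real, Real.norm_of_nonneg (expKerProd_nonneg _)]
      exact expKerProd_le_one _
    have hz1 : Integrable fun y => (expKerProd (y - z) : ℂ) * f y :=
      h1.bdd_mul hm (Filter.Eventually.of_forall hb)
    have hz2 : MemLp (fun y => (expKerProd (y - z) : ℂ) * f y) 2 := by
      refine h2.mono hz1.aestronglyMeasurable (Filter.Eventually.of_forall fun y => ?_)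
      rw [norm_mul]
      exact mul_le_of_le_one_left (norm_nonneg _) (hb y)
    rw [← lintegral_enorm_fourier_phase hz1 hz2]
    simp only [wavePacket, mul_left_comm]
  have hle : ∀ y z : Vec n, ‖(expKerProd (y - z) : ℂ) * f y‖ₑ ^ 2
      ≤ ENNReal.ofReal (expKerProd (y - z)) * ‖f y‖ₑ ^ 2 := by
    intro y z
    have h0 := expKerProd_nonneg (y - z)
    have h1 := expKerProd_le_one (y - z)
    rw [enorm_mul, mul_pow]
    gcongr
    rw [← ofReal_norm, Complex.norm_real, Real.norm_of_nonneg h0,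
      ← ENNReal.ofReal_pow h0]
    exact ENNReal.ofReal_le_ofReal (by nlinarith)
  rw [lintegral_lintegral_swap
    ((stronglyMeasurable_wavePacket hf).enorm.comp measurable_swap |>.pow_const 2).aemeasurable]
  simp_rw [hz]
  rw [lintegral_const_mul' _ _ ENNReal.ofReal_ne_top, ENNReal.ofReal_mul (by positivity), mul_assoc]
  gcongr
  calc ∫⁻ z, ∫⁻ y, ‖(expKerProd (y - z) : ℂ) * f y‖ₑ ^ 2
      ≤ ∫⁻ z, ∫⁻ y, ENNReal.ofReal (expKerProd (y - z)) * ‖f y‖ₑ ^ 2 :=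
        lintegral_mono fun z => lintegral_mono fun y => hle y z
    _ = ∫⁻ y, ∫⁻ z, ENNReal.ofReal (expKerProd (y - z)) * ‖f y‖ₑ ^ 2 := by
        refine lintegral_lintegral_swap ?_
        exact ((hE.comp measurable_swap).ennreal_ofReal.mul
          ((hf.comp measurable_snd).enorm.pow_const 2)).aemeasurable
    _ = _ := by
        have h3 : ∀ y : Vec n, ∫⁻ z, ENNReal.ofReal (expKerProd (y - z)) * ‖f y‖ₑ ^ 2
            = ENNReal.ofReal (∫ t : Vec n, expKerProd t) * ‖f y‖ₑ ^ 2 := by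
          intro y
          rw [lintegral_mul_const' _ _ (by finiteness),
            lintegral_sub_left_eq_self (fun t => ENNReal.ofReal (expKerProd t)) y,
            ofReal_integral_eq_lintegral_ofReal integrable_expKerProd
              (Filter.Eventually.of_forall expKerProd_nonneg)]
        simp_rw [h3]
        rw [lintegral_const_mul' _ _ ENNReal.ofReal_ne_top]

end WavePackets

section Pairing

variable {n : ℕ}

/-- The operator `∏ⱼ (1 + ∂_{q j})` on functions of `(q, p, q')`. -/
noncomputable def firstOp (g : Vec n × Vec n × Vec n → ℂ) : Vec n × Vec n × Vec n → ℂ :=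
  dirOpList (List.ofFn fun j => emb₁ n (Pi.single j 1)) g

/-- The operator `∏ⱼ (1 + ∂_{q' j})` on functions of `(q, p, q')`. -/
noncomputable def thirdOp (g : Vec n × Vec n × Vec n → ℂ) : Vec n × Vec n × Vec n → ℂ :=
  dirOpList (List.ofFn fun j => emb₃ n (Pi.single j 1)) g

lemma sum_smul_map_single {X : Type*} [NormedAddCommGroup X] [NormedSpace ℝ X]
    (T : Vec n →L[ℝ] X) (t : Vec n) : ∑ j, t j • T (Pi.single j 1) = T t := by
  simp_rw [← map_smul, ← map_sum]
  congr 1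
  funext i
  simp [Finset.sum_apply, Pi.single_apply]

variable {g : Vec n × Vec n × Vec n → ℂ} {W : Vec n × Vec n × Vec n → ℝ} {S : ℝ} {M : ℕ}

lemma contDiff_firstOp (hg : ContDiff ℝ (⊤ : ℕ∞) g) : ContDiff ℝ (⊤ : ℕ∞) (firstOp g) :=
  contDiff_dirOpList hg _

lemma contDiff_thirdOp (hg : ContDiff ℝ (⊤ : ℕ∞) g) : ContDiff ℝ (⊤ : ℕ∞) (thirdOp g) :=
  contDiff_dirOpList hg _

lemma emb₁_single_mem (j : Fin n) : emb₁ n (Pi.single j 1) ∈ coordDirs n :=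
  ⟨j, Or.inl rfl⟩

lemma emb₂_single_mem (j : Fin n) : emb₂ n (Pi.single j 1) ∈ coordDirs n :=
  ⟨j, Or.inr (Or.inl rfl)⟩

lemma emb₃_single_mem (j : Fin n) : emb₃ n (Pi.single j 1) ∈ coordDirs n :=
  ⟨j, Or.inr (Or.inr rfl)⟩

lemma DerivBound.firstOp (hg : ContDiff ℝ (⊤ : ℕ∞) g)
    (bg : DerivBound (coordDirs n) W S (M + n) g) :
    DerivBound (coordDirs n) W (2 ^ n * S) M (_root_.firstOp g) := by
  have h := DerivBound.dirOpList (M := M) (L := List.ofFn fun j => emb₁ n (Pi.single j 1)) hg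
    (fun d hd => by
      obtain ⟨j, rfl⟩ := (List.mem_ofFn' _ d).1 hd
      exact Or.inl (emb₁_single_mem j))
    (by simpa using! bg)
  simpa using! h

lemma DerivBound.thirdOp (hg : ContDiff ℝ (⊤ : ℕ∞) g)
    (bg : DerivBound (coordDirs n) W S (M + n) g) :
    DerivBound (coordDirs n) W (2 ^ n * S) M (_root_.thirdOp g) := by
  have h := DerivBound.dirOpList (M := M) (L := List.ofFn fun j => emb₃ n (Pi.single j 1)) hg
    (fun d hd => by
      obtain ⟨j, rfl⟩ := (List.mem_ofFn' _ d).1 hd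
      exact Or.inl (emb₃_single_mem j))
    (by simpa using! bg)
  simpa using! h

lemma integral_expKerProd_mul_thirdOp (hg : ContDiff ℝ (⊤ : ℕ∞) g)
    (bg : DerivBound (coordDirs n) (fun _ => 1) S n g) (q p q' : Vec n) :
    ∫ z, (expKerProd (q' - z) : ℂ) * thirdOp g (q, p, z) = g (q, p, q') := by
  rw [← integral_expKerProd_mul_dirOpList hg (d := fun j => emb₃ n (Pi.single j 1))
    emb₃_single_mem bg (q, p, q'),
    ← integral_sub_left_eq_self _ (volume : Measure (Vec n)) q']
  simp only [sum_smul_map_single, sub_sub_cancel]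
  simp [thirdOp, emb₃]

lemma integral_expKerProd_mul_firstOp (hg : ContDiff ℝ (⊤ : ℕ∞) g)
    (bg : DerivBound (coordDirs n) (fun _ => 1) S n g) (q p q' : Vec n) :
    ∫ w, (expKerProd (q - w) : ℂ) * firstOp g (w, p, q') = g (q, p, q') := by
  rw [← integral_expKerProd_mul_dirOpList hg (d := fun j => emb₁ n (Pi.single j 1))
    emb₁_single_mem bg (q, p, q'),
    ← integral_sub_left_eq_self _ (volume : Measure (Vec n)) q]
  simp only [sum_smul_map_single, sub_sub_cancel]
  simp [firstOp, emb₁]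

lemma phase_neg_zero (p q : Vec n) : phase (-p) 0 q = phase p q 0 := by
  simp [phase]

lemma stronglyMeasurable_integral_mul_phase {m : Vec n × Vec n × Vec n → ℂ} (hm : Continuous m)
    {u : Vec n → ℂ} (hu : Measurable u) :
    StronglyMeasurable fun x : Vec n × Vec n =>
      ∫ q', m (x.1, x.2, q') * phase x.2 x.1 q' * u q' := by
  have h : Measurable fun x : (Vec n × Vec n) × Vec n =>
      m (x.1.1, x.1.2, x.2) * phase x.1.2 x.1.1 x.2 * u x.2 :=
    ((hm.comp (by fun_prop : Continuous fun x : (Vec n × Vec n) × Vec n =>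
      (x.1.1, x.1.2, x.2))).mul (continuous_phase.comp
        (by fun_prop : Continuous fun x : (Vec n × Vec n) × Vec n =>
          (x.1.1, x.1.2, x.2)))).measurable.mul (hu.comp measurable_snd)
  exact h.stronglyMeasurable.integral_prod_right

lemma norm_integral_mul_phase_le {m : Vec n × Vec n × Vec n → ℂ} {B : ℝ} {u : Vec n → ℂ}
    (hu : Integrable u) {q p : Vec n} (hB : ∀ q', ‖m (q, p, q')‖ ≤ B) :
    ‖∫ q', m (q, p, q') * phase p q q' * u q'‖ ≤ B * ∫ q', ‖u q'‖ := by
  rw [← integral_const_mul]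
  refine norm_integral_le_of_norm_le (hu.norm.const_mul B) (Filter.Eventually.of_forall fun q' => ?_)
  rw [norm_mul, norm_mul, norm_phase, mul_one]
  gcongr
  exact hB q'

lemma integral_mul_oscillatory_eq {m : Vec n × Vec n × Vec n → ℂ}
    (hm : ContDiff ℝ (⊤ : ℕ∞) m) {V : Vec n → ℝ} {T : ℝ} (hT : 0 ≤ T)
    (bm : DerivBound (coordDirs n) (fun x => V x.2.1) T (n + n) m) (hV : Integrable V)
    (hV1 : ∀ p, V p ≤ 1) {u v : Vec n → ℂ} (hu : Integrable u)
    (hv : Integrable v) (hum : Measurable u) :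
    ∫ q, v q * ∫ p, ∫ q', m (q, p, q') * phase p q q' * u q'
      = ∫ p, ∫ z, wavePacket u z p *
          ∫ w, firstOp (thirdOp m) (w, p, z) * wavePacket v w (-p) := by
  have b1 : DerivBound (coordDirs n) (fun _ => 1) T (n + n) m :=
    bm.mono fun x => mul_le_mul_of_nonneg_left (hV1 _) hT
  have hm3 := contDiff_thirdOp hm
  have b3 := b1.thirdOp hm
  have b13 := b3.norm_le
  have hm13 := contDiff_firstOp hm3
  have bc := DerivBound.firstOp (M := 0) hm3 (by simpa using! b3) |>.norm_le
  simp only [mul_one] at b13 bc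
  have inner1 : ∀ q p, ∫ q', m (q, p, q') * phase p q q' * u q'
      = phase p q 0 * ∫ z, thirdOp m (q, p, z) * wavePacket u z p := by
    intro q p
    have h := integral_mul_integral_expKerProd (integrable_phase_mul hu p)
      (hm3.continuous.comp (by fun_prop : Continuous fun z : Vec n => (q, p, z)))
      (fun z => b13 (q, p, z))
    change _ = ∫ z, thirdOp m (q, p, z) * wavePacket u z p at h
    rw [← h, ← integral_const_mul]
    congr 1
    funext q'
    simp only [Function.comp_apply]
    rw [integral_expKerProd_mul_thirdOp hm (b1.of_le (by omega)), phase_sub p q q']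
    ring
  have hJ : Integrable (fun x : Vec n × Vec n =>
      v x.1 * ∫ q', m (x.1, x.2, q') * phase x.2 x.1 q' * u q') (volume.prod volume) := by
    refine Integrable.mono' ((hv.norm.mul_prod hV).const_mul (T * ∫ q', ‖u q'‖)) ?_
      (Filter.Eventually.of_forall fun x => ?_)
    · exact hv.aestronglyMeasurable.comp_fst.mul
        (stronglyMeasurable_integral_mul_phase hm.continuous hum).aestronglyMeasurable
    · rw [norm_mul]
      refine (mul_le_mul_of_nonneg_left (norm_integral_mul_phase_le (B := T * V x.2) hu
        fun q' => bm.norm_le (x.1, x.2, q')) (norm_nonneg _)).trans (le_of_eq ?_)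
      ring
  calc ∫ q, v q * ∫ p, ∫ q', m (q, p, q') * phase p q q' * u q'
      = ∫ q, ∫ p, v q * ∫ q', m (q, p, q') * phase p q q' * u q' := by
        simp_rw [integral_const_mul]
    _ = ∫ p, ∫ q, v q * ∫ q', m (q, p, q') * phase p q q' * u q' := integral_integral_swap hJ
    _ = _ := by
        congr 1
        funext p
        have hU := integrable_wavePacket hu p
        have hvp := integrable_phase_mul hv (-p)
        have hi : Integrable (fun x : Vec n × Vec n => thirdOp m (x.1, p, x.2) *
            ((phase (-p) 0 x.1 * v x.1) * wavePacket u x.2 p)) (volume.prod volume) :=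
          (hvp.mul_prod hU).bdd_mul (hm3.continuous.comp (by fun_prop)).aestronglyMeasurable
            (Filter.Eventually.of_forall fun x => b13 _)
        calc ∫ q, v q * ∫ q', m (q, p, q') * phase p q q' * u q'
            = ∫ q, ∫ z, thirdOp m (q, p, z) *
                ((phase (-p) 0 q * v q) * wavePacket u z p) := by
              congr 1
              funext q
              rw [inner1, ← mul_assoc, ← integral_const_mul, phase_neg_zero]
              congr 1
              funext z
              ring
          _ = ∫ z, ∫ q, thirdOp m (q, p, z) *
                ((phase (-p) 0 q * v q) * wavePacket u z p) := integral_integral_swap hi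
          _ = _ := by
              congr 1
              funext z
              have h := integral_mul_integral_expKerProd hvp
                (hm13.continuous.comp (by fun_prop : Continuous fun w : Vec n => (w, p, z)))
                (fun w => bc (w, p, z))
              simp only [Function.comp_def, integral_expKerProd_mul_firstOp hm3 b3] at h
              change _ = ∫ w, firstOp (thirdOp m) (w, p, z) * wavePacket v w (-p) at h
              rw [← h, mul_comm (wavePacket u z p), ← integral_mul_const]
              congr 1
              funext q
              ring

end Pairing

section BilinearBound

variable {n : ℕ}

/-- The kernel `∏ⱼ (1 + tⱼ²)⁻¹`. -/
noncomputable def cauchyKer (t : Vec n) : ℝ := ∏ j, (1 + t j ^ 2)⁻¹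

lemma cauchyKer_nonneg (t : Vec n) : 0 ≤ cauchyKer t :=
  Finset.prod_nonneg fun _ _ => by positivity

lemma cauchyKer_le_one (t : Vec n) : cauchyKer t ≤ 1 :=
  Finset.prod_le_one (fun _ _ => by positivity) fun j _ =>
    inv_le_one_of_one_le₀ (by nlinarith [sq_nonneg (t j)])

lemma continuous_cauchyKer : Continuous (cauchyKer : Vec n → ℝ) :=
  continuous_finsetProd _ fun j _ => Continuous.inv₀ (by fun_prop) fun t => by positivity

lemma integrable_cauchyKer : Integrable (cauchyKer : Vec n → ℝ) :=
  Integrable.fintype_prod fun _ => integrable_inv_one_add_sq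

lemma lintegral_lintegral_sub_mul_add {k A B : Vec n → ENNReal} (hk : Measurable k)
    (hA : Measurable A) (hB : Measurable B) :
    ∫⁻ z, ∫⁻ w, k (w - z) * (A z + B w) = (∫⁻ t, k t) * ((∫⁻ z, A z) + ∫⁻ w, B w) := by
  have h1 : ∀ z, ∫⁻ w, k (w - z) * (A z + B w)
      = (∫⁻ t, k t) * A z + ∫⁻ w, k (w - z) * B w := by
    intro z
    simp_rw [mul_add]
    rw [lintegral_add_left (by fun_prop), lintegral_mul_const _ (by fun_prop),
      lintegral_sub_right_eq_self k z]
  simp_rw [h1]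
  rw [lintegral_add_left (by fun_prop), lintegral_const_mul _ hA, mul_add]
  congr 1
  rw [lintegral_lintegral_swap (by fun_prop), ← lintegral_const_mul _ hB]
  congr 1
  funext w
  rw [lintegral_mul_const _ (by fun_prop), lintegral_sub_left_eq_self k w]

lemma enorm_mul_enorm_le (x y : ℂ) {l : ℝ} (hl : 0 < l) :
    ‖x‖ₑ * ‖y‖ₑ ≤ ENNReal.ofReal l * ‖x‖ₑ ^ 2 + ENNReal.ofReal l⁻¹ * ‖y‖ₑ ^ 2 := by
  simp only [← ofReal_norm]
  rw [← ENNReal.ofReal_mul (norm_nonneg x), ← ENNReal.ofReal_pow (norm_nonneg x),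
    ← ENNReal.ofReal_pow (norm_nonneg y), ← ENNReal.ofReal_mul hl.le,
    ← ENNReal.ofReal_mul (by positivity), ← ENNReal.ofReal_add (by positivity) (by positivity)]
  refine ENNReal.ofReal_le_ofReal ?_
  have h : l * ‖x‖ ^ 2 + l⁻¹ * ‖y‖ ^ 2 - ‖x‖ * ‖y‖
      = l⁻¹ * ((l * ‖x‖ - ‖y‖ / 2) ^ 2 + 3 / 4 * ‖y‖ ^ 2) := by
    field_simp
    ring
  have h2 : 0 ≤ l⁻¹ * ((l * ‖x‖ - ‖y‖ / 2) ^ 2 + 3 / 4 * ‖y‖ ^ 2) := by positivity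
  linarith

lemma enorm_integral_kernel_le {c : Vec n × Vec n × Vec n → ℂ} {K : ℝ} (hK : 0 ≤ K)
    (hc : ∀ x, ‖c x‖ ≤ K * cauchyKer (x.1 - x.2.2)) {U V : Vec n → Vec n → ℂ}
    (hU : StronglyMeasurable fun x : Vec n × Vec n => U x.1 x.2)
    (hV : StronglyMeasurable fun x : Vec n × Vec n => V x.1 x.2) {l : ℝ} (hl : 0 < l) :
    ‖∫ p, ∫ z, U z p * ∫ w, c (w, p, z) * V w (-p)‖ₑ
      ≤ ENNReal.ofReal (K * ∫ t : Vec n, cauchyKer t) *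
        (ENNReal.ofReal l * (∫⁻ p, ∫⁻ z, ‖U z p‖ₑ ^ 2)
          + ENNReal.ofReal l⁻¹ * ∫⁻ p, ∫⁻ w, ‖V w p‖ₑ ^ 2) := by
  have hU2 : Measurable fun x : Vec n × Vec n => ‖U x.2 x.1‖ₑ ^ 2 :=
    (hU.enorm.comp measurable_swap).pow_const 2
  have hV2 : Measurable fun x : Vec n × Vec n => ‖V x.2 x.1‖ₑ ^ 2 :=
    (hV.enorm.comp measurable_swap).pow_const 2
  have hk : Measurable fun t : Vec n => ENNReal.ofReal (K * cauchyKer t) :=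
    (continuous_const.mul continuous_cauchyKer).measurable.ennreal_ofReal
  have hkint : ∫⁻ t : Vec n, ENNReal.ofReal (K * cauchyKer t)
      = ENNReal.ofReal (K * ∫ t : Vec n, cauchyKer t) := by
    rw [← integral_const_mul, ofReal_integral_eq_lintegral_ofReal
      (integrable_cauchyKer.const_mul K)
      (Filter.Eventually.of_forall fun t => mul_nonneg hK (cauchyKer_nonneg t))]
  have hpt : ∀ p z w, ‖U z p‖ₑ * ‖c (w, p, z) * V w (-p)‖ₑ
      ≤ ENNReal.ofReal (K * cauchyKer (w - z)) *
        (ENNReal.ofReal l * ‖U z p‖ₑ ^ 2 + ENNReal.ofReal l⁻¹ * ‖V w (-p)‖ₑ ^ 2) := by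
    intro p z w
    rw [enorm_mul, mul_left_comm]
    refine mul_le_mul' ?_ (enorm_mul_enorm_le _ _ hl)
    rw [← ofReal_norm]
    exact ENNReal.ofReal_le_ofReal (hc _)
  have hneg : ∫⁻ p, ∫⁻ w, ‖V w (-p)‖ₑ ^ 2 = ∫⁻ p, ∫⁻ w, ‖V w p‖ₑ ^ 2 :=
    lintegral_neg_eq_self (μ := volume) fun p => ∫⁻ w, ‖V w p‖ₑ ^ 2
  calc ‖∫ p, ∫ z, U z p * ∫ w, c (w, p, z) * V w (-p)‖ₑ
      ≤ ∫⁻ p, ∫⁻ z, ∫⁻ w, ‖U z p‖ₑ * ‖c (w, p, z) * V w (-p)‖ₑ := by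
        refine (enorm_integral_le_lintegral_enorm _).trans (lintegral_mono fun p => ?_)
        refine (enorm_integral_le_lintegral_enorm _).trans (lintegral_mono fun z => ?_)
        rw [enorm_mul, lintegral_const_mul' _ _ (by finiteness)]
        gcongr
        exact enorm_integral_le_lintegral_enorm _
    _ ≤ ∫⁻ p, ∫⁻ z, ∫⁻ w, ENNReal.ofReal (K * cauchyKer (w - z)) *
        (ENNReal.ofReal l * ‖U z p‖ₑ ^ 2 + ENNReal.ofReal l⁻¹ * ‖V w (-p)‖ₑ ^ 2) :=
        lintegral_mono fun p => lintegral_mono fun z => lintegral_mono fun w => hpt p z w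
    _ = ∫⁻ p, ENNReal.ofReal (K * ∫ t : Vec n, cauchyKer t) *
        (ENNReal.ofReal l * (∫⁻ z, ‖U z p‖ₑ ^ 2)
          + ENNReal.ofReal l⁻¹ * ∫⁻ w, ‖V w (-p)‖ₑ ^ 2) := by
        congr 1
        funext p
        have mA : Measurable fun z => ‖U z p‖ₑ ^ 2 :=
          hU2.comp (by fun_prop : Measurable fun z : Vec n => (p, z))
        have mB : Measurable fun w => ‖V w (-p)‖ₑ ^ 2 :=
          hV2.comp (by fun_prop : Measurable fun w : Vec n => (-p, w))
        rw [lintegral_lintegral_sub_mul_add hk (mA.const_mul _) (mB.const_mul _), hkint,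
          lintegral_const_mul _ mA, lintegral_const_mul _ mB]
    _ = _ := by
        have mV : Measurable fun p => ∫⁻ w, ‖V w (-p)‖ₑ ^ 2 :=
          (hV2.lintegral_prod_right').comp measurable_neg
        rw [lintegral_const_mul' _ _ ENNReal.ofReal_ne_top,
          lintegral_add_left (hU2.lintegral_prod_right'.const_mul _),
          lintegral_const_mul' _ _ ENNReal.ofReal_ne_top,
          lintegral_const_mul' _ _ ENNReal.ofReal_ne_top, hneg]

/-- The dimensional constant in the bilinear estimate. -/
noncomputable def pairingConst (n : ℕ) : ℝ :=
  2 ^ n * 2 ^ n * (∫ t : Vec n, cauchyKer t) * ((2 * π) ^ n * ∫ t : Vec n, expKerProd t)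

lemma pairingConst_nonneg : 0 ≤ pairingConst n := by
  have h1 : 0 ≤ ∫ t : Vec n, cauchyKer t := integral_nonneg cauchyKer_nonneg
  have h2 : 0 ≤ ∫ t : Vec n, expKerProd t := integral_nonneg expKerProd_nonneg
  unfold pairingConst
  positivity

lemma enorm_integral_mul_oscillatory_le {m : Vec n × Vec n × Vec n → ℂ}
    (hm : ContDiff ℝ (⊤ : ℕ∞) m) {V : Vec n → ℝ} {T : ℝ} (hT : 0 ≤ T)
    (bm : DerivBound (coordDirs n) (fun x => cauchyKer (x.1 - x.2.2) * V x.2.1) T (n + n) m)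
    (hV : Integrable V) (hV0 : ∀ p, 0 ≤ V p) (hV1 : ∀ p, V p ≤ 1) {u v : Vec n → ℂ}
    (hum : Measurable u) (hu1 : Integrable u) (hu2 : MemLp u 2)
    (hvm : Measurable v) (hv1 : Integrable v) (hv2 : MemLp v 2) {l : ℝ} (hl : 0 < l) :
    ‖∫ q, v q * ∫ p, ∫ q', m (q, p, q') * phase p q q' * u q'‖ₑ
      ≤ ENNReal.ofReal (pairingConst n * T) *
        (ENNReal.ofReal l * (∫⁻ y, ‖u y‖ₑ ^ 2) + ENNReal.ofReal l⁻¹ * ∫⁻ y, ‖v y‖ₑ ^ 2) := by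
  have bV : DerivBound (coordDirs n) (fun x => V x.2.1) T (n + n) m :=
    bm.mono fun x => mul_le_mul_of_nonneg_left
      (mul_le_of_le_one_left (hV0 _) (cauchyKer_le_one _)) hT
  have bR : DerivBound (coordDirs n) (fun x => cauchyKer (x.1 - x.2.2)) T (n + n) m :=
    bm.mono fun x => mul_le_mul_of_nonneg_left
      (mul_le_of_le_one_right (cauchyKer_nonneg _) (hV1 _)) hT
  have bc := DerivBound.firstOp (M := 0) (contDiff_thirdOp hm)
    (by simpa using! bR.thirdOp hm) |>.norm_le
  rw [integral_mul_oscillatory_eq hm hT bV hV hV1 hu1 hv1 hum]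
  refine (enorm_integral_kernel_le (by positivity) bc (stronglyMeasurable_wavePacket hum)
    (stronglyMeasurable_wavePacket hvm) hl).trans ?_
  have h0 : 0 ≤ (2 * π) ^ n * ∫ t : Vec n, expKerProd t :=
    mul_nonneg (by positivity) (integral_nonneg expKerProd_nonneg)
  have h1 : 0 ≤ ∫ t : Vec n, cauchyKer t := integral_nonneg cauchyKer_nonneg
  have hsplit : pairingConst n * T = 2 ^ n * (2 ^ n * T) * (∫ t : Vec n, cauchyKer t) *
      ((2 * π) ^ n * ∫ t : Vec n, expKerProd t) := by
    unfold pairingConst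
    ring
  have h2 : 0 ≤ 2 ^ n * (2 ^ n * T) * ∫ t : Vec n, cauchyKer t := by positivity
  rw [hsplit, ENNReal.ofReal_mul h2, mul_assoc (ENNReal.ofReal _), mul_add
    (ENNReal.ofReal ((2 * π) ^ n * _)), mul_left_comm _ (ENNReal.ofReal l),
    mul_left_comm _ (ENNReal.ofReal l⁻¹)]
  gcongr
  · exact lintegral_enorm_wavePacket_le hum hu1 hu2
  · exact lintegral_enorm_wavePacket_le hvm hv1 hv2

end BilinearBound

section RegularizedAmplitude

variable {n : ℕ}

/-- The functional `(q, p, q') ↦ p j`. -/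
noncomputable def momentumCoord (j : Fin n) : Vec n × Vec n × Vec n →L[ℝ] ℝ :=
  (ContinuousLinearMap.proj j).comp
    ((ContinuousLinearMap.fst ℝ _ _).comp (ContinuousLinearMap.snd ℝ _ _))

@[simp] lemma momentumCoord_apply (j : Fin n) (x : Vec n × Vec n × Vec n) :
    momentumCoord j x = x.2.1 j := rfl

/-- The list of all coordinates, each occurring twice. -/
def doubledRange (n : ℕ) : List (Fin n) := List.finRange n ++ List.finRange n

@[simp] lemma length_doubledRange : (doubledRange n).length = n + n := by
  simp [doubledRange]

lemma norm_invFactorProd_le_one {X : Type*} [NormedAddCommGroup X] [NormedSpace ℝ X]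
    (L : List (X →L[ℝ] ℝ)) (x : X) : ‖invFactorProd L x‖ ≤ 1 := by
  induction L with
  | nil => simp [invFactorProd]
  | cons l L ih =>
    simp only [invFactorProd, List.map_cons, List.prod_cons, norm_mul]
    exact mul_le_one₀ (norm_inv_one_add_I_mul_le_one _) (norm_nonneg _) ih

lemma norm_invFactorProd_doubledRange {X : Type*} [NormedAddCommGroup X] [NormedSpace ℝ X]
    (l : Fin n → X →L[ℝ] ℝ) (x : X) :
    ‖invFactorProd ((doubledRange n).map l) x‖ = cauchyKer fun j => l j x := by
  have h : ∀ t : ℝ, ‖(1 + Complex.I * (t : ℂ))⁻¹‖ * ‖(1 + Complex.I * (t : ℂ))⁻¹‖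
      = (1 + t ^ 2)⁻¹ := by
    intro t
    rw [norm_inv, ← mul_inv, ← sq, normSq_one_add_I_mul]
  have h2 : ((List.finRange n).map fun j => invFactor (l j) x).prod
      = ∏ j, invFactor (l j) x := by
    rw [← List.ofFn_eq_map, List.prod_ofFn]
  simp only [invFactorProd, doubledRange, List.map_append, List.prod_append, List.map_map,
    Function.comp_def, norm_mul, h2, norm_prod, cauchyKer]
  rw [← Finset.prod_mul_distrib]
  exact Finset.prod_congr rfl fun j _ => h _

lemma abs_diffCoord_le_one (j : Fin n) {d : Vec n × Vec n × Vec n} (hd : d ∈ coordDirs n) :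
    |diffCoord j d| ≤ 1 := by
  obtain ⟨i, rfl | rfl | rfl⟩ := hd <;> by_cases h : j = i <;> simp [h]

lemma abs_momentumCoord_le_one (j : Fin n) {d : Vec n × Vec n × Vec n}
    (hd : d ∈ coordDirs n) : |momentumCoord j d| ≤ 1 := by
  obtain ⟨i, rfl | rfl | rfl⟩ := hd <;> by_cases h : j = i <;> simp [h]

/-- A convergence factor in the momentum variable, tending to `1` as `ε → 0`. -/
noncomputable def cutoff (ε : ℝ) : Vec n × Vec n × Vec n → ℂ :=
  invFactorProd ((doubledRange n).map fun j => ε • momentumCoord j)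

lemma contDiff_cutoff (ε : ℝ) : ContDiff ℝ (⊤ : ℕ∞) (cutoff (n := n) ε) :=
  contDiff_invFactorProd _

lemma norm_cutoff (ε : ℝ) (x : Vec n × Vec n × Vec n) :
    ‖cutoff ε x‖ = cauchyKer (ε • x.2.1) :=
  norm_invFactorProd_doubledRange _ x

lemma norm_cutoff_le_one (ε : ℝ) (x : Vec n × Vec n × Vec n) : ‖cutoff ε x‖ ≤ 1 :=
  (norm_cutoff ε x).trans_le (cauchyKer_le_one _)

lemma cutoff_eq (ε : ℝ) (q p q' : Vec n) : cutoff ε (q, p, q') = cutoff ε (0, p, 0) := by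
  simp [cutoff, invFactorProd, invFactor, Function.comp_def]

lemma continuous_cutoff_param (x : Vec n × Vec n × Vec n) :
    Continuous fun ε : ℝ => cutoff ε x := by
  simp only [cutoff, invFactorProd, List.map_map]
  refine continuous_list_prod _ fun j _ => ?_
  simp only [Function.comp_def, invFactor, FunLike.coe_smul, Pi.smul_apply, smul_eq_mul]
  exact Continuous.inv₀ (by fun_prop) fun ε => one_add_I_mul_ne_zero _

lemma cutoff_zero (x : Vec n × Vec n × Vec n) : cutoff 0 x = 1 := by
  simp [cutoff, invFactorProd, invFactor]

lemma integrable_cauchyKer_smul {ε : ℝ} (hε : 0 < ε) :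
    Integrable fun p : Vec n => cauchyKer (ε • p) :=
  integrable_cauchyKer.comp_smul hε.ne'

lemma integral_integral_phase_swap {b : Vec n × Vec n × Vec n → ℂ} (hb : Continuous b)
    {S : ℝ} {V : Vec n → ℝ} (bb : ∀ x, ‖b x‖ ≤ S * V x.2.1) (hV : Integrable V)
    {u : Vec n → ℂ} (hu : Integrable u) (q : Vec n) :
    ∫ p, ∫ q', b (q, p, q') * phase p q q' * u q'
      = ∫ q', (∫ p, b (q, p, q') * phase p q q') * u q' := by
  have hi : Integrable (fun x : Vec n × Vec n =>
      b (q, x.1, x.2) * phase x.1 q x.2 * u x.2) (volume.prod volume) := by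
    refine Integrable.mono' ((hV.mul_prod hu.norm).const_mul S) ?_
      (Filter.Eventually.of_forall fun x => ?_)
    · have hc : Continuous fun x : Vec n × Vec n => (q, x.1, x.2) := by fun_prop
      exact ((hb.comp hc).mul (continuous_phase.comp hc)).aestronglyMeasurable.mul
        hu.aestronglyMeasurable.comp_snd
    · rw [norm_mul, norm_mul, norm_phase, mul_one, ← mul_assoc]
      exact mul_le_mul_of_nonneg_right (bb _) (norm_nonneg _)
  rw [integral_integral_swap hi]
  simp_rw [integral_mul_const]

/-- The amplitude obtained from `b` by integrating by parts along `L` in the momentum. -/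
noncomputable def momentumByParts (L : List (Fin n)) (b : Vec n × Vec n × Vec n → ℂ) :
    Vec n × Vec n × Vec n → ℂ :=
  fun x => invFactorProd (L.map diffCoord) x *
    dirOpList (L.map fun j => -emb₂ n (Pi.single j 1)) b x

lemma contDiff_momentumByParts (L : List (Fin n)) {b : Vec n × Vec n × Vec n → ℂ}
    (hb : ContDiff ℝ (⊤ : ℕ∞) b) : ContDiff ℝ (⊤ : ℕ∞) (momentumByParts L b) :=
  (contDiff_invFactorProd _).mul (contDiff_dirOpList hb _)

lemma integral_integral_phase_eq_momentumByParts {b : Vec n × Vec n × Vec n → ℂ}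
    (hb : ContDiff ℝ (⊤ : ℕ∞) b) {S : ℝ} {V : Vec n → ℝ} (L : List (Fin n))
    (bb : DerivBound (coordDirs n) (fun x => V x.2.1) S L.length b) (hV : Integrable V)
    {u : Vec n → ℂ} (hu : Integrable u) (q : Vec n) :
    ∫ p, ∫ q', b (q, p, q') * phase p q q' * u q'
      = ∫ p, ∫ q', momentumByParts L b (q, p, q') * phase p q q' * u q' := by
  have bd := DerivBound.dirOpList (M := 0) (L := L.map fun j => -emb₂ n (Pi.single j 1)) hb
    (fun d hd => by
      obtain ⟨j, -, rfl⟩ := List.mem_map.1 hd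
      exact Or.inr (by simpa using! emb₂_single_mem j)) (by simpa using! bb) |>.norm_le
  have bm : ∀ x, ‖momentumByParts L b x‖
      ≤ (2 ^ (L.map fun j => -emb₂ n (Pi.single j 1)).length * S) * V x.2.1 := by
    intro x
    rw [momentumByParts, norm_mul]
    exact (mul_le_of_le_one_left (norm_nonneg _) (norm_invFactorProd_le_one _ x)).trans (bd x)
  rw [integral_integral_phase_swap hb.continuous bb.norm_le hV hu,
    integral_integral_phase_swap (contDiff_momentumByParts L hb).continuous bm hV hu]
  congr 1
  funext q'
  rw [integral_mul_phase_eq_invFactorProd L hb bb hV, ← integral_const_mul]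
  congr 2
  funext p
  have e : invFactorProd (L.map diffCoord) (q, 0, q')
      = invFactorProd (L.map diffCoord) (q, p, q') := by
    simp [invFactorProd, invFactor, Function.comp_def]
  rw [momentumByParts, e, mul_assoc]

lemma exists_enorm_integral_mul_cutoff_le (n : ℕ) : ∃ K : ℝ, 0 ≤ K ∧
    ∀ (a : Vec n × Vec n × Vec n → ℂ) (S : ℝ), ContDiff ℝ (⊤ : ℕ∞) a → 0 ≤ S →
      DerivBound (coordDirs n) (fun _ => 1) S (n + n + (n + n)) a →
      ∀ ε : ℝ, 0 < ε → ε ≤ 1 → ∀ u v : Vec n → ℂ, Measurable u → Integrable u → MemLp u 2 →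
        Measurable v → Integrable v → MemLp v 2 → ∀ l : ℝ, 0 < l →
        ‖∫ q, v q * ∫ p, ∫ q', (a (q, p, q') * cutoff ε (q, p, q')) * phase p q q' * u q'‖ₑ
          ≤ ENNReal.ofReal (K * S) * (ENNReal.ofReal l * (∫⁻ y, ‖u y‖ₑ ^ 2)
            + ENNReal.ofReal l⁻¹ * ∫⁻ y, ‖v y‖ₑ ^ 2) := by
  obtain ⟨C₁, hC₁, h₁⟩ := DerivBound.invFactorProd (D := coordDirs n) (n + n + (n + n)) (n + n)
  obtain ⟨C₂, hC₂, h₂⟩ := DerivBound.invFactorProd (D := coordDirs n) (n + n) (n + n)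
  refine ⟨pairingConst n * (2 ^ (n + n) * (C₂ * (2 ^ (n + n) * (2 ^ (n + n + (n + n)) * C₁)))),
    mul_nonneg pairingConst_nonneg (by positivity), ?_⟩
  intro a S ha hS ba ε hε hε1 u v hum hu1 hu2 hvm hv1 hv2 l hl
  set b : Vec n × Vec n × Vec n → ℂ := fun x => a x * cutoff ε x with hb_def
  have hb : ContDiff ℝ (⊤ : ℕ∞) b := ha.mul (contDiff_cutoff ε)
  have bcut := h₁ ((doubledRange n).map fun j => ε • momentumCoord j) (by simp) (by
    intro f hf d hd
    obtain ⟨j, -, rfl⟩ := List.mem_map.1 hf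
    have := abs_momentumCoord_le_one j hd
    simp only [FunLike.coe_smul, Pi.smul_apply, smul_eq_mul, abs_mul, abs_of_pos hε]
    nlinarith [abs_nonneg (momentumCoord j d)])
  have bb : DerivBound (coordDirs n) (fun x => cauchyKer (ε • x.2.1))
      (2 ^ (n + n + (n + n)) * (S * C₁)) (n + n + (n + n)) b :=
    (DerivBound.mul hS (by linarith) (fun _ => zero_le_one) (fun _ => norm_nonneg _) ha
      (contDiff_cutoff ε) ba bcut).mono fun x => by
        rw [one_mul]
        exact (congrArg _ (norm_cutoff ε x)).le
  have bd := DerivBound.dirOpList (M := n + n)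
    (L := (doubledRange n).map fun j => -emb₂ n (Pi.single j 1)) hb (fun d hd => by
      obtain ⟨j, -, rfl⟩ := List.mem_map.1 hd
      exact Or.inr (by simpa using! emb₂_single_mem j)) (by simpa using! bb)
  have bdiff := h₂ ((doubledRange n).map diffCoord) (by simp) (by
    intro f hf d hd
    obtain ⟨j, -, rfl⟩ := List.mem_map.1 hf
    exact abs_diffCoord_le_one j hd)
  have bm : DerivBound (coordDirs n) (fun x => cauchyKer (x.1 - x.2.2) * cauchyKer (ε • x.2.1))
      (2 ^ (n + n) * (C₂ * (2 ^ (n + n) * (2 ^ (n + n + (n + n)) * (S * C₁))))) (n + n)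
      (momentumByParts (doubledRange n) b) :=
    (DerivBound.mul (by linarith) (by positivity) (fun _ => norm_nonneg _)
      (fun _ => cauchyKer_nonneg _) (contDiff_invFactorProd _) (contDiff_dirOpList hb _)
      bdiff bd).mono fun x => by
        rw [norm_invFactorProd_doubledRange, List.length_map, length_doubledRange]
        rfl
  have hK : pairingConst n * (2 ^ (n + n) * (C₂ * (2 ^ (n + n) *
      (2 ^ (n + n + (n + n)) * C₁)))) * S = pairingConst n *
      (2 ^ (n + n) * (C₂ * (2 ^ (n + n) * (2 ^ (n + n + (n + n)) * (S * C₁))))) := by ring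
  have hF : ∀ q, ∫ p, ∫ q', (a (q, p, q') * cutoff ε (q, p, q')) * phase p q q' * u q'
      = ∫ p, ∫ q', momentumByParts (doubledRange n) b (q, p, q') * phase p q q' * u q' :=
    fun q => integral_integral_phase_eq_momentumByParts hb (doubledRange n) (bb.of_le (by simp))
      (integrable_cauchyKer_smul hε) hu1 q
  simp_rw [hF]
  rw [hK]
  exact enorm_integral_mul_oscillatory_le (contDiff_momentumByParts _ hb) (by positivity) bm
    (integrable_cauchyKer_smul hε) (fun _ => cauchyKer_nonneg _) (fun _ => cauchyKer_le_one _)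
    hum hu1 hu2 hvm hv1 hv2 hl

end RegularizedAmplitude

section SquareIntegrability

variable {n : ℕ}

lemma setLIntegral_enorm_sq_le_of_bilinear {F : Vec n → ℂ} (hF : Measurable F) {B K : ℝ}
    (hB : ∀ q, ‖F q‖ ≤ B) (hK : 0 ≤ K) {A : ENNReal} (hA : A ≠ ⊤)
    (h : ∀ v : Vec n → ℂ, Measurable v → Integrable v → MemLp v 2 → ∀ l : ℝ, 0 < l →
      ‖∫ q, v q * F q‖ₑ ≤ ENNReal.ofReal K * (ENNReal.ofReal l * A
        + ENNReal.ofReal l⁻¹ * ∫⁻ y, ‖v y‖ₑ ^ 2)) {s : Set (Vec n)} (hs : MeasurableSet s)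
    (hsf : volume s ≠ ⊤) :
    ∫⁻ q in s, ‖F q‖ₑ ^ 2 ≤ ENNReal.ofReal (4 * K ^ 2) * A := by
  set v : Vec n → ℂ := s.indicator fun q => (starRingEnd ℂ) (F q) with hv
  have hconj : Measurable fun q => (starRingEnd ℂ) (F q) :=
    Complex.continuous_conj.measurable.comp hF
  have hvm : Measurable v := hconj.indicator hs
  have hLp : ∀ p, MemLp v p := fun p => by
    rw [hv, memLp_indicator_iff_restrict hs]
    have : IsFiniteMeasure (volume.restrict s) := ⟨by simpa using hsf.lt_top⟩
    exact MemLp.of_bound hconj.aestronglyMeasurable B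
      (Filter.Eventually.of_forall fun q => by simpa using hB q)
  have hF2 : Integrable fun q => s.indicator (fun q => ‖F q‖ ^ 2) q := by
    rw [integrable_indicator_iff hs]
    refine Measure.integrableOn_of_bounded (M := B ^ 2) hsf
      (hF.norm.pow_const 2).aestronglyMeasurable
      (Filter.Eventually.of_forall fun q => ?_)
    rw [Real.norm_of_nonneg (by positivity)]
    exact pow_le_pow_left₀ (norm_nonneg _) (hB q) 2
  set Y := ∫ q, s.indicator (fun q => ‖F q‖ ^ 2) q with hY
  have hY0 : 0 ≤ Y := integral_nonneg fun q => Set.indicator_nonneg (fun _ _ => by positivity) q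
  have hYl : ∫⁻ q in s, ‖F q‖ₑ ^ 2 = ENNReal.ofReal Y := by
    rw [hY, ofReal_integral_eq_lintegral_ofReal hF2 (Filter.Eventually.of_forall fun q =>
      Set.indicator_nonneg (fun _ _ => by positivity) q), ← lintegral_indicator hs]
    congr 1
    funext q
    by_cases hq : q ∈ s
    · simp [hq, ENNReal.ofReal_pow (norm_nonneg _)]
    · simp [hq]
  have hvl : ∫⁻ y, ‖v y‖ₑ ^ 2 = ENNReal.ofReal Y := by
    rw [← hYl, ← lintegral_indicator hs]
    congr 1
    funext q
    by_cases hq : q ∈ s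
    · simp [hv, hq, ← ofReal_norm]
    · simp [hv, hq]
  have hvF : ∫ q, v q * F q = (Y : ℂ) := by
    rw [hY, ← integral_complex_ofReal]
    congr 1
    funext q
    by_cases hq : q ∈ s
    · simp [hv, hq, Complex.conj_mul']
    · simp [hv, hq]
  have hb := h v hvm ((memLp_one_iff_integrable).1 (hLp 1)) (hLp 2)
  rw [hvF, hvl] at hb
  have hYe : ‖(Y : ℂ)‖ₑ = ENNReal.ofReal Y := by
    rw [← ofReal_norm, Complex.norm_real, Real.norm_of_nonneg hY0]
  rw [hYe] at hb
  rw [hYl]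
  have hb' : ∀ l : ℝ, 0 < l → Y ≤ K * (l * A.toReal + l⁻¹ * Y) := by
    intro l hl
    have := hb l hl
    have hl' := inv_pos.2 hl
    rw [← ENNReal.ofReal_toReal hA, ← ENNReal.ofReal_mul hl.le, ← ENNReal.ofReal_mul hl'.le,
      ← ENNReal.ofReal_add (by positivity) (by positivity), ← ENNReal.ofReal_mul hK] at this
    exact (ENNReal.ofReal_le_ofReal_iff (by positivity)).1 this
  rw [← ENNReal.ofReal_toReal hA, ← ENNReal.ofReal_mul (by positivity)]
  refine ENNReal.ofReal_le_ofReal ?_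
  rcases hK.eq_or_lt with rfl | hK
  · simpa using hb' 1 one_pos
  · have h1 := hb' (2 * K) (by positivity)
    have h2 : K * (2 * K * A.toReal + (2 * K)⁻¹ * Y) = 2 * K ^ 2 * A.toReal + Y / 2 := by
      field_simp
    linarith

lemma exists_lintegral_enorm_sq_oscillatory_le (n : ℕ) : ∃ K : ℝ, 0 ≤ K ∧
    ∀ (a : Vec n × Vec n × Vec n → ℂ) (S : ℝ), ContDiff ℝ (⊤ : ℕ∞) a → 0 ≤ S →
      DerivBound (coordDirs n) (fun _ => 1) S (n + n + (n + n)) a →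
      ∀ u : Vec n → ℂ, Measurable u → Integrable u → MemLp u 2 →
        ∫⁻ q, ‖∫ p, ∫ q', a (q, p, q') * phase p q q' * u q'‖ₑ ^ 2
          ≤ ENNReal.ofReal ((K * S) ^ 2) * ∫⁻ y, ‖u y‖ₑ ^ 2 := by
  obtain ⟨K, hK, hmain⟩ := exists_enorm_integral_mul_cutoff_le n
  refine ⟨2 * K, by positivity, ?_⟩
  intro a S ha hS ba u hum hu1 hu2
  have hA : ∫⁻ y, ‖u y‖ₑ ^ 2 ≠ ⊤ := by
    have := (hu2.integrable_norm_pow (by norm_num)).2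
    simpa [HasFiniteIntegral, enorm_pow] using this.ne
  set I : Vec n → Vec n → ℂ := fun q p => ∫ q', a (q, p, q') * phase p q q' * u q' with hI
  have hIm : StronglyMeasurable fun x : Vec n × Vec n => I x.1 x.2 :=
    stronglyMeasurable_integral_mul_phase ha.continuous hum
  have hIb : ∀ q p, ‖I q p‖ ≤ S * ∫ q', ‖u q'‖ := fun q p =>
    norm_integral_mul_phase_le hu1 fun q' => by simpa using ba.norm_le (q, p, q')
  set F : ℝ → Vec n → ℂ := fun ε q => ∫ p, cutoff ε (0, p, 0) * I q p with hF
  have hcm : ∀ ε, Continuous fun p : Vec n => cutoff ε (0, p, 0) := fun ε =>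
    (contDiff_cutoff ε).continuous.comp (by fun_prop)
  have hFe : ∀ ε q, ∫ p, ∫ q', (a (q, p, q') * cutoff ε (q, p, q')) * phase p q q' * u q'
      = F ε q := by
    intro ε q
    simp only [hF, hI]
    congr 1
    funext p
    rw [← integral_const_mul]
    congr 1
    funext q'
    rw [cutoff_eq]
    ring
  have hFm : ∀ ε, Measurable (F ε) := fun ε =>
    (((hcm ε).comp continuous_snd).stronglyMeasurable.mul hIm).integral_prod_right.measurable
  have hFb : ∀ ε, 0 < ε → ∀ q, ‖F ε q‖
      ≤ (S * ∫ q', ‖u q'‖) * ∫ p : Vec n, cauchyKer (ε • p) := by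
    intro ε hε q
    rw [← integral_const_mul]
    refine norm_integral_le_of_norm_le ((integrable_cauchyKer_smul hε).const_mul _)
      (Filter.Eventually.of_forall fun p => ?_)
    rw [norm_mul, norm_cutoff, mul_comm]
    exact mul_le_mul_of_nonneg_right (hIb q p) (cauchyKer_nonneg _)
  set e : ℕ → ℝ := fun k => 1 / ((k : ℝ) + 1) with he
  have he0 : ∀ k, 0 < e k := fun k => by positivity
  have he1 : ∀ k, e k ≤ 1 := fun k => by
    simp only [he]
    rw [div_le_one (by positivity)]
    linarith [Nat.cast_nonneg (α := ℝ) k]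
  have hstep : ∀ k : ℕ, ∫⁻ q in Metric.closedBall (0 : Vec n) k, ‖F (e k) q‖ₑ ^ 2
      ≤ ENNReal.ofReal ((2 * K * S) ^ 2) * ∫⁻ y, ‖u y‖ₑ ^ 2 := by
    intro k
    have h := setLIntegral_enorm_sq_le_of_bilinear (hFm (e k)) (hFb (e k) (he0 k))
      (mul_nonneg hK hS) hA (fun v hvm hv1 hv2 l hl => by
        simpa only [hFe] using hmain a S ha hS ba (e k) (he0 k) (he1 k) u v hum hu1 hu2
          hvm hv1 hv2 l hl) (Metric.isClosed_closedBall.measurableSet)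
      (measure_closedBall_lt_top (x := (0 : Vec n)) (r := k)).ne
    refine h.trans (le_of_eq ?_)
    congr 2
    ring
  set G : ℕ → Vec n → ENNReal := fun k =>
    (Metric.closedBall (0 : Vec n) k).indicator fun q => ‖F (e k) q‖ₑ ^ 2 with hG
  have hpt : ∀ q, ‖∫ p, I q p‖ₑ ^ 2 ≤ Filter.liminf (fun k => G k q) Filter.atTop := by
    intro q
    by_cases hi : Integrable (I q)
    · have ht : Filter.Tendsto (fun k => F (e k) q) Filter.atTop (nhds (∫ p, I q p)) := by
        refine tendsto_integral_of_dominated_convergence (fun p => ‖I q p‖)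
          (fun k => (hcm _).aestronglyMeasurable.mul hi.aestronglyMeasurable) hi.norm
          (fun k => Filter.Eventually.of_forall fun p => ?_)
          (Filter.Eventually.of_forall fun p => ?_)
        · rw [norm_mul]
          exact mul_le_of_le_one_left (norm_nonneg _) (norm_cutoff_le_one _ _)
        · have h0 := ((continuous_cutoff_param ((0 : Vec n), p, (0 : Vec n))).tendsto 0).comp
            (tendsto_one_div_add_atTop_nhds_zero_nat (𝕜 := ℝ))
          rw [cutoff_zero] at h0
          simpa [he] using! h0.mul_const (I q p)
      have ht2 : Filter.Tendsto (fun k => G k q) Filter.atTop (nhds (‖∫ p, I q p‖ₑ ^ 2)) := by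
        refine ((ENNReal.continuous_pow 2).tendsto _ |>.comp ht.enorm).congr' ?_
        filter_upwards [Filter.eventually_ge_atTop ⌈‖q‖⌉₊] with k hk
        have hq : q ∈ Metric.closedBall (0 : Vec n) k := by
          rw [mem_closedBall_zero_iff]
          exact (Nat.le_ceil _).trans (by exact_mod_cast hk)
        simp [hG, hq]
      exact ht2.liminf_eq.ge
    · simp [integral_undef hi]
  calc ∫⁻ q, ‖∫ p, I q p‖ₑ ^ 2
      ≤ ∫⁻ q, Filter.liminf (fun k => G k q) Filter.atTop := lintegral_mono hpt
    _ ≤ Filter.liminf (fun k => ∫⁻ q, G k q) Filter.atTop :=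
        lintegral_liminf_le fun k => ((hFm (e k)).enorm.pow_const 2).indicator
          Metric.isClosed_closedBall.measurableSet
    _ ≤ _ := by
        refine Filter.liminf_le_of_frequently_le' (Filter.Frequently.of_forall fun k => ?_)
        rw [hG, lintegral_indicator Metric.isClosed_closedBall.measurableSet]
        exact hstep k

lemma L2_le_of_lintegral_le {f u : Vec n → ℂ} {K : ℝ} (hK : 0 ≤ K) (hu : MemLp u 2)
    (h : ∫⁻ q, ‖f q‖ₑ ^ 2 ≤ ENNReal.ofReal (K ^ 2) * ∫⁻ q, ‖u q‖ₑ ^ 2) :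
    L2 f ≤ K * L2 u := by
  have hu2 : ∫⁻ q, ‖u q‖ₑ ^ 2 = ENNReal.ofReal (∫ q, ‖u q‖ ^ 2) := by
    rw [ofReal_integral_eq_lintegral_ofReal (hu.integrable_norm_pow (by norm_num))
      (Filter.Eventually.of_forall fun q => by positivity)]
    simp [ENNReal.ofReal_pow]
  have hu0 : 0 ≤ ∫ q, ‖u q‖ ^ 2 := integral_nonneg fun q => by positivity
  have hle : ∫ q, ‖f q‖ ^ 2 ≤ K ^ 2 * ∫ q, ‖u q‖ ^ 2 := by
    by_cases hi : Integrable fun q => ‖f q‖ ^ 2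
    · rw [hu2, ← ENNReal.ofReal_mul (by positivity)] at h
      refine (ENNReal.ofReal_le_ofReal_iff (by positivity)).1 (le_trans (le_of_eq ?_) h)
      rw [ofReal_integral_eq_lintegral_ofReal hi
        (Filter.Eventually.of_forall fun q => by positivity)]
      simp [ENNReal.ofReal_pow]
    · rw [integral_undef hi]
      positivity
  calc L2 f ≤ Real.sqrt (K ^ 2 * ∫ q, ‖u q‖ ^ 2) := Real.sqrt_le_sqrt hle
    _ = K * L2 u := by rw [Real.sqrt_mul (by positivity), Real.sqrt_sq hK, L2]

lemma L2_const_mul (c : ℂ) (f : Vec n → ℂ) : L2 (fun q => c * f q) = ‖c‖ * L2 f := by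
  simp only [L2, norm_mul, mul_pow, integral_const_mul]
  rw [Real.sqrt_mul (by positivity), Real.sqrt_sq (norm_nonneg _)]

end SquareIntegrability

/-- **Proposition 3.4 (1) (Calderón–Vaillancourt theorem for bounded bisymbols).**
There exist `C > 0` and an integer `M ≥ 0` such that
`‖Op(a)u‖_{L²(dq)} ≤ C |a|_{M,0,0} ‖u‖_{L²(dq)}` for all bisymbols `a ∈ BS⁰₀(1)`
and all `u ∈ C_c^∞(ℝⁿ)`. -/
theorem CalderonVaillancourt_flat
    (n : ℕ) [NeZero n] :
    ∃ C > 0, ∃ M : ℕ, ∀ a : Vec n → Vec n → Vec n → ℂ, IsBisymbolOne 0 0 a →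
      ∀ u : Vec n → ℂ, ContDiff ℝ (⊤ : ℕ∞) u → HasCompactSupport u →
        L2 (Op a u) ≤ C * bisymSeminormOne M 0 0 a * L2 u := by
  obtain ⟨K, hK, h⟩ := exists_lintegral_enorm_sq_oscillatory_le n
  set c : ℝ := (2 * Real.pi) ^ (-(n : ℤ)) with hc
  have hc0 : 0 < c := by positivity
  refine ⟨c * (K + 1), by positivity, n + n + (n + n), fun a ha u hu hus => ?_⟩
  have ba := derivBound_of_isBisymbolOne ha (n + n + (n + n))
  set S := bisymSeminormOne (n + n + (n + n)) 0 0 a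
  have hS : 0 ≤ S := by
    simpa using (norm_nonneg _).trans (ba.norm_le 0)
  have hu2 : MemLp u 2 := hu.continuous.memLp_of_hasCompactSupport hus
  have h1 := L2_le_of_lintegral_le (mul_nonneg hK hS) hu2
    (h _ S ha.1 hS ba u hu.continuous.measurable
      (hu.continuous.integrable_of_hasCompactSupport hus) hu2)
  have hL : 0 ≤ L2 u := Real.sqrt_nonneg _
  unfold Op
  rw [L2_const_mul, Complex.norm_real, Real.norm_of_nonneg hc0.le]
  calc _ ≤ c * (K * S * L2 u) := by gcongr
    _ ≤ c * ((K + 1) * S * L2 u) := by gcongr; linarith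
    _ = _ := by ring
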